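/- arXiv:2507.14033 — 2 statements merged into one kernel-verified Lean document; each statement's English description precedes it below -/
import Mathlib

section
/- Let x ∈ W with x ∉ X and x ≠ e. Then: if x ∈ Θ, then x has exactly 6 Bruhat covers, i.e. |U(x)| = 6; if x ∈ Θ^s, then |U(x)| = 5; and if x ∈ sΘs, then |U(x)| = 4. -/
noncomputable section

open scoped RealInnerProductSpace

/-- The Bruhat strict order on a Coxeter group: the transitive closure of the relation
"multiply on the left by a reflection, increasing the length". -/
def bruhatLT {B : Type*} {W : Type*} [Group W] {M : CoxeterMatrix B}
    (cs : CoxeterSystem M W) : W → W → Prop :=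
  Relation.TransGen (fun a b => (∃ t, cs.IsReflection t ∧ b = t * a) ∧ cs.length a < cs.length b)

/-- The Bruhat order on a Coxeter group. -/
def bruhatLE {B : Type*} {W : Type*} [Group W] {M : CoxeterMatrix B}
    (cs : CoxeterSystem M W) (x y : W) : Prop :=
  x = y ∨ bruhatLT cs x y

/-- The Bruhat interval `[x, y]` as a set. -/
def Iset {B : Type*} {W : Type*} [Group W] {M : CoxeterMatrix B}
    (cs : CoxeterSystem M W) (x y : W) : Set W :=
  {z | bruhatLE cs x z ∧ bruhatLE cs z y}

/-- The Bruhat covers `U(x)` of an element `x`. -/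
def Uset {B : Type*} {W : Type*} [Group W] {M : CoxeterMatrix B}
    (cs : CoxeterSystem M W) (x : W) : Set W :=
  {w | bruhatLT cs x w ∧ cs.length w = cs.length x + 1}

/-- The Bruhat cocovers `L(y)` of an element `y`. -/
def Lset {B : Type*} {W : Type*} [Group W] {M : CoxeterMatrix B}
    (cs : CoxeterSystem M W) (y : W) : Set W :=
  {w | bruhatLT cs w y ∧ cs.length y = cs.length w + 1}

/-- An interval `[x, y]` is full if it contains all Bruhat covers of `x` and all
Bruhat cocovers of `y`. -/
def FullInt {B : Type*} {W : Type*} [Group W] {M : CoxeterMatrix B}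
    (cs : CoxeterSystem M W) (x y : W) : Prop :=
  Uset cs x ⊆ Iset cs x y ∧ Lset cs y ⊆ Iset cs x y

/-- Two Bruhat intervals (possibly in different Coxeter groups) are isomorphic as posets. -/
def IntervalIso {B : Type*} {W : Type*} {B' : Type*} {W' : Type*} [Group W] [Group W']
    {M : CoxeterMatrix B} {M' : CoxeterMatrix B'}
    (cs : CoxeterSystem M W) (cs' : CoxeterSystem M' W') (x y : W) (x' y' : W') : Prop :=
  ∃ f : {z : W // bruhatLE cs x z ∧ bruhatLE cs z y} ≃
        {z : W' // bruhatLE cs' x' z ∧ bruhatLE cs' z y'},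
    ∀ u v, bruhatLE cs u.1 v.1 ↔ bruhatLE cs' (f u).1 (f v).1

/-- The group `G` of generic automorphisms: the subgroup of the permutation group of `W`
generated by the Dynkin diagram automorphisms `δ`, `σ` and inversion. -/
def Gsub {W : Type*} [Group W] (dl sg : W ≃* W) : Subgroup (Equiv.Perm W) :=
  Subgroup.closure {dl.toEquiv, sg.toEquiv, Equiv.inv W}

/-- The Euclidean plane, with coordinates taken in the basis of simple roots of `A₂`. -/
abbrev E2 : Type := ℝ × ℝ

/-- The `A₂` inner product on the plane, in which `(αᵢ, αᵢ) = 2` and `(α₁, α₂) = -1`. -/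
def B2 (u v : E2) : ℝ := 2*u.1*v.1 - u.1*v.2 - u.2*v.1 + 2*u.2*v.2

/-- The simple root `α₁`. -/
def a1 : E2 := (1, 0)
/-- The simple root `α₂`. -/
def a2 : E2 := (0, 1)
/-- The fundamental weight `ϖ₁`, satisfying `(αᵢ, ϖⱼ) = δᵢⱼ`. -/
def fw1 : E2 := (2/3, 1/3)
/-- The fundamental weight `ϖ₂`. -/
def fw2 : E2 := (1/3, 2/3)
/-- `ρ = ϖ₁ + ϖ₂ = α₁ + α₂`. -/
def rho2 : E2 := (1, 1)

/-- The affine reflection `s_{α,k}` of the plane in the line `{v | (α, v) = k}`,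
for a root `α` with `(α, α) = 2`. -/
def reflE (a : E2) (k : ℝ) (v : E2) : E2 := v - (B2 a v - k) • a

/-- The barycenter of the alcove of `z`, i.e. the image under the affine action of `z` of
the barycenter `-ρ/3` of the fundamental alcove (whose vertices are `0, -ϖ₁, -ϖ₂`). -/
def cen {W : Type*} [Group W] (act : W →* Equiv.Perm E2) (z : W) : E2 :=
  act z ((-(1/3 : ℝ)) • rho2)

/-- The weight lattice `Λ = ℤϖ₁ ⊕ ℤϖ₂`. -/
def wLat : Set E2 := {v | ∃ a b : ℤ, v = (a : ℝ) • fw1 + (b : ℝ) • fw2}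

/-- The fundamental alcove `A₊`. -/
def AlcoveFund : Set E2 :=
  {v | (-1 < B2 a1 v ∧ B2 a1 v < 0) ∧ (-1 < B2 a2 v ∧ B2 a2 v < 0) ∧
    (-1 < B2 rho2 v ∧ B2 rho2 v < 0)}

/-- The zone `F_id` of the plane. -/
def Fid : Set E2 := {v | -1 ≤ B2 a1 v ∧ -1 ≤ B2 a2 v ∧ -1 ≤ B2 rho2 v}

/-- The cone `K` of nonnegative combinations of the simple roots. -/
def coneK : Set E2 := {v | ∃ a b : ℝ, 0 ≤ a ∧ 0 ≤ b ∧ v = a • a1 + b • a2}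

/-- The set `D` of dominant elements, given functions `θ, θˢ` enumerating them. -/
def Dset {W : Type*} (th ths : ℕ → ℕ → W) : Set W :=
  {w | (∃ m n, w = th m n) ∨ (∃ m n, w = ths m n)}

/-- The polygon `Pgn_{x,y} = F_id ∩ (cen x + K) ∩ (cen y - K)`. -/
def Pgn {W : Type*} [Group W] (act : W →* Equiv.Perm E2) (x y : W) : Set E2 :=
  {v ∈ Fid | (∃ k ∈ coneK, v = cen act x + k) ∧ (∃ k ∈ coneK, v = cen act y - k)}

/-- The element `x_k`: the product of the first `k` terms of `s₁, s₂, s₀, s₁, s₂, s₀, …`. -/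
def xelt {W : Type*} [Group W] {M : CoxeterMatrix (Fin 3)} (cs : CoxeterSystem M W)
    (k : ℕ) : W :=
  ((List.range k).map (fun j => cs.simple (⟨(j + 1) % 3, Nat.mod_lt _ (by norm_num)⟩ : Fin 3))).prod

/-- `zoneOf cs w v` says that `w` is one of the six elements of `W_f` and `v` lies in the
corresponding zone `F_w` of the plane. -/
def zoneOf {W : Type*} [Group W] {M : CoxeterMatrix (Fin 3)} (cs : CoxeterSystem M W)
    (w : W) (v : E2) : Prop :=
  (w = 1 ∧ v ∈ Fid) ∨
  (w = cs.simple 1 ∧ B2 a1 v ≤ -1 ∧ -1 ≤ B2 rho2 v) ∨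
  (w = cs.simple 2 ∧ B2 a2 v ≤ -1 ∧ -1 ≤ B2 rho2 v) ∨
  (w = cs.simple 1 * cs.simple 2 ∧ B2 rho2 v ≤ -1 ∧ 0 ≤ B2 a2 v) ∨
  (w = cs.simple 2 * cs.simple 1 ∧ B2 rho2 v ≤ -1 ∧ 0 ≤ B2 a1 v) ∨
  (w = cs.simple 1 * cs.simple 2 * cs.simple 1 ∧ B2 a1 v ≤ 0 ∧ B2 a2 v ≤ 0)

/-- Thickness of the interval `[x,y]`: `x + 2αᵢ` and `y - 2αᵢ` belong to `[x,y]` and their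
barycenters lie in `F_id`, for `i = 1, 2`. -/
def Thick {W : Type*} [Group W] {M : CoxeterMatrix (Fin 3)} (cs : CoxeterSystem M W)
    (act : W →* Equiv.Perm E2) (Wadd : W → E2 → W) (x y : W) : Prop :=
  Wadd x ((2 : ℝ) • a1) ∈ Iset cs x y ∧ Wadd x ((2 : ℝ) • a2) ∈ Iset cs x y ∧
  Wadd y (-((2 : ℝ) • a1)) ∈ Iset cs x y ∧ Wadd y (-((2 : ℝ) • a2)) ∈ Iset cs x y ∧
  cen act (Wadd x ((2 : ℝ) • a1)) ∈ Fid ∧ cen act (Wadd x ((2 : ℝ) • a2)) ∈ Fid ∧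
  cen act (Wadd y (-((2 : ℝ) • a1))) ∈ Fid ∧ cen act (Wadd y (-((2 : ℝ) • a2))) ∈ Fid

/-- The point `v` of the plane with `(α₁, v) = a / 3` and `(α₂, v) = b / 3`. -/
def gridPoint (q : ℤ × ℤ) : E2 := ((2 * q.1 + q.2 : ℝ) / 9, (q.1 + 2 * q.2 : ℝ) / 9)

/-- The number of affine root lines separating the alcove with barycenter `gridPoint q` from the
fundamental alcove. -/
def sepCount (q : ℤ × ℤ) : ℕ :=
  (q.1 / 3 + 1).natAbs + (q.2 / 3 + 1).natAbs + ((q.1 + q.2) / 3 + 1).natAbs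

/-- `gridPoint q` is the barycenter of an alcove. -/
def IsAlcovePoint (q : ℤ × ℤ) : Prop :=
  ∃ i j : ℤ, q = (3 * i + 1, 3 * j + 1) ∨ q = (3 * i + 2, 3 * j + 2)

/-- The reflection `s_{α₁,k}` in `gridPoint` coordinates. -/
def gridRefl₁ (k : ℤ) (q : ℤ × ℤ) : ℤ × ℤ := (6 * k - q.1, q.1 + q.2 - 3 * k)
/-- The reflection `s_{α₂,k}` in `gridPoint` coordinates. -/
def gridRefl₂ (k : ℤ) (q : ℤ × ℤ) : ℤ × ℤ := (q.1 + q.2 - 3 * k, 6 * k - q.2)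
/-- The reflection `s_{ρ,k}` in `gridPoint` coordinates. -/
def gridReflρ (k : ℤ) (q : ℤ × ℤ) : ℤ × ℤ := (3 * k - q.2, 3 * k - q.1)

lemma gridPoint_injective : Function.Injective gridPoint := by
  rintro ⟨a, b⟩ ⟨c, d⟩ h
  simp only [gridPoint, Prod.mk.injEq] at h
  obtain ⟨h1, h2⟩ := h
  have ha : (a : ℝ) = c := by linarith
  have hb : (b : ℝ) = d := by linarith
  rw [Int.cast_inj.1 ha, Int.cast_inj.1 hb]

lemma reflE_a1_gridPoint (k : ℤ) (q : ℤ × ℤ) :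
    reflE a1 k (gridPoint q) = gridPoint (gridRefl₁ k q) := by
  ext <;> simp [reflE, B2, a1, gridPoint, gridRefl₁] <;> ring

lemma reflE_a2_gridPoint (k : ℤ) (q : ℤ × ℤ) :
    reflE a2 k (gridPoint q) = gridPoint (gridRefl₂ k q) := by
  ext <;> simp [reflE, B2, a2, gridPoint, gridRefl₂] <;> ring

lemma reflE_rho2_gridPoint (k : ℤ) (q : ℤ × ℤ) :
    reflE rho2 k (gridPoint q) = gridPoint (gridReflρ k q) := by
  ext <;> simp [reflE, B2, rho2, gridPoint, gridReflρ] <;> ring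

lemma sepCount_one (i j : ℤ) : sepCount (3 * i + 1, 3 * j + 1) =
    (i + 1).natAbs + (j + 1).natAbs + (i + j + 1).natAbs := by
  rw [sepCount, show (3 * i + 1) / 3 = i by omega, show (3 * j + 1) / 3 = j by omega,
    show (3 * i + 1 + (3 * j + 1)) / 3 = i + j by omega]

lemma sepCount_two (i j : ℤ) : sepCount (3 * i + 2, 3 * j + 2) =
    (i + 1).natAbs + (j + 1).natAbs + (i + j + 2).natAbs := by
  rw [sepCount, show (3 * i + 2) / 3 = i by omega, show (3 * j + 2) / 3 = j by omega,
    show (3 * i + 2 + (3 * j + 2)) / 3 = i + j + 1 by omega, add_assoc (i + j)]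
  rfl

lemma gridRefl₁_one (k i j : ℤ) : gridRefl₁ k (3 * i + 1, 3 * j + 1) =
    (3 * (2 * k - i - 1) + 2, 3 * (i + j - k) + 2) := by
  ext <;> simp only [gridRefl₁] <;> ring

lemma gridRefl₁_two (k i j : ℤ) : gridRefl₁ k (3 * i + 2, 3 * j + 2) =
    (3 * (2 * k - i - 1) + 1, 3 * (i + j - k + 1) + 1) := by
  ext <;> simp only [gridRefl₁] <;> ring

lemma gridRefl₂_one (k i j : ℤ) : gridRefl₂ k (3 * i + 1, 3 * j + 1) =
    (3 * (i + j - k) + 2, 3 * (2 * k - j - 1) + 2) := by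
  ext <;> simp only [gridRefl₂] <;> ring

lemma gridRefl₂_two (k i j : ℤ) : gridRefl₂ k (3 * i + 2, 3 * j + 2) =
    (3 * (i + j - k + 1) + 1, 3 * (2 * k - j - 1) + 1) := by
  ext <;> simp only [gridRefl₂] <;> ring

lemma gridReflρ_one (k i j : ℤ) : gridReflρ k (3 * i + 1, 3 * j + 1) =
    (3 * (k - j - 1) + 2, 3 * (k - i - 1) + 2) := by
  ext <;> simp only [gridReflρ] <;> ring

lemma gridReflρ_two (k i j : ℤ) : gridReflρ k (3 * i + 2, 3 * j + 2) =
    (3 * (k - j - 1) + 1, 3 * (k - i - 1) + 1) := by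
  ext <;> simp only [gridReflρ] <;> ring

lemma IsAlcovePoint.gridRefl₁ {q : ℤ × ℤ} (h : IsAlcovePoint q) (k : ℤ) :
    IsAlcovePoint (gridRefl₁ k q) := by
  obtain ⟨i, j, rfl | rfl⟩ := h
  · exact ⟨_, _, .inr (gridRefl₁_one k i j)⟩
  · exact ⟨_, _, .inl (gridRefl₁_two k i j)⟩

lemma IsAlcovePoint.gridRefl₂ {q : ℤ × ℤ} (h : IsAlcovePoint q) (k : ℤ) :
    IsAlcovePoint (gridRefl₂ k q) := by
  obtain ⟨i, j, rfl | rfl⟩ := h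
  · exact ⟨_, _, .inr (gridRefl₂_one k i j)⟩
  · exact ⟨_, _, .inl (gridRefl₂_two k i j)⟩

lemma IsAlcovePoint.gridReflρ {q : ℤ × ℤ} (h : IsAlcovePoint q) (k : ℤ) :
    IsAlcovePoint (gridReflρ k q) := by
  obtain ⟨i, j, rfl | rfl⟩ := h
  · exact ⟨_, _, .inr (gridReflρ_one k i j)⟩
  · exact ⟨_, _, .inl (gridReflρ_two k i j)⟩

/-- The images of `q` under the simple reflections `s₀, s₁, s₂`. -/
def gridSimple (q : ℤ × ℤ) (i : Fin 3) : ℤ × ℤ :=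
  ![gridReflρ (-1) q, gridRefl₁ 0 q, gridRefl₂ 0 q] i

lemma IsAlcovePoint.gridSimple {q : ℤ × ℤ} (h : IsAlcovePoint q) (i : Fin 3) :
    IsAlcovePoint (gridSimple q i) := by
  fin_cases i
  · exact h.gridReflρ _
  · exact h.gridRefl₁ _
  · exact h.gridRefl₂ _

lemma IsAlcovePoint.sepCount_gridSimple_le {q : ℤ × ℤ} (h : IsAlcovePoint q) (i : Fin 3) :
    sepCount (_root_.gridSimple q i) ≤ sepCount q + 1 := by
  obtain ⟨a, b, rfl | rfl⟩ := h <;> fin_cases i <;>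
    simp only [_root_.gridSimple, gridReflρ_one, gridReflρ_two, gridRefl₁_one, gridRefl₁_two,
      gridRefl₂_one, gridRefl₂_two, sepCount_one, sepCount_two, Fin.zero_eta, Fin.mk_one,
      Fin.reduceFinMk, Matrix.cons_val] <;> omega

lemma IsAlcovePoint.exists_sepCount_gridSimple_lt {q : ℤ × ℤ} (h : IsAlcovePoint q)
    (hq : q ≠ (-1, -1)) : ∃ i, sepCount (_root_.gridSimple q i) + 1 = sepCount q := by
  simp only [_root_.gridSimple, Fin.exists_fin_succ, Fin.isValue, Matrix.cons_val,
    Fin.succ_zero_eq_one, Fin.succ_one_eq_two, IsEmpty.exists_iff, or_false]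
  obtain ⟨a, b, rfl | rfl⟩ := h <;>
    simp only [gridReflρ_one, gridReflρ_two, gridRefl₁_one, gridRefl₁_two,
      gridRefl₂_one, gridRefl₂_two, sepCount_one, sepCount_two, ne_eq, Prod.mk.injEq] at hq ⊢ <;>
    omega

/-- The coordinates of the Bruhat covers of the alcove with coordinates `q`. -/
def coverPoints (q : ℤ × ℤ) : Set (ℤ × ℤ) :=
  {p | sepCount p = sepCount q + 1 ∧
    ∃ k, p = gridRefl₁ k q ∨ p = gridRefl₂ k q ∨ p = gridReflρ k q}

lemma ncard_coverPoints_theta (m n : ℕ) {q : ℤ × ℤ}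
    (hq : q = (3 * (m : ℤ) + 1, 3 * (n : ℤ) + 1)) : (coverPoints q).ncard = 6 := by
  have h : coverPoints q = (({gridRefl₁ (m + 1) q, gridRefl₁ (-1) q, gridRefl₂ (n + 1) q, gridRefl₂ (-1) q,
      gridReflρ (m + n + 1) q, gridReflρ (-1) q} :
      Finset (ℤ × ℤ)) : Set (ℤ × ℤ)) := by
    subst hq
    ext p
    simp only [coverPoints, Set.mem_ofPred_eq, Finset.coe_insert, Finset.coe_singleton,
      Set.mem_insert_iff, Set.mem_singleton_iff]
    constructor
    · rintro ⟨hf, k, rfl | rfl | rfl⟩ <;>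
        simp only [gridRefl₁_one, gridRefl₂_one, gridReflρ_one, sepCount_one, sepCount_two] at hf
      · obtain rfl | rfl : k = m + 1 ∨ k = -1 := by omega
        all_goals simp
      · obtain rfl | rfl : k = n + 1 ∨ k = -1 := by omega
        all_goals simp
      · obtain rfl | rfl : k = m + n + 1 ∨ k = -1 := by omega
        all_goals simp
    · rintro (rfl | rfl | rfl | rfl | rfl | rfl)
      all_goals
        refine ⟨?_, _, by tauto⟩
        simp only [gridRefl₁_one, gridRefl₂_one, gridReflρ_one, sepCount_one, sepCount_two]
        omega
  rw [h, Set.ncard_coe_finset]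
  subst hq
  repeat rw [Finset.card_insert_of_notMem (by
    simp only [gridRefl₁_one, gridRefl₂_one, gridReflρ_one, Finset.mem_insert,
      Finset.mem_singleton, Prod.mk.injEq]
    omega)]
  simp

lemma ncard_coverPoints_thetaS (m n : ℕ) {q : ℤ × ℤ}
    (hq : q = (3 * (m : ℤ) + 2, 3 * (n : ℤ) + 2)) : (coverPoints q).ncard = 5 := by
  have h : coverPoints q = (({gridRefl₁ (m + 1) q, gridRefl₁ (-1) q, gridRefl₂ (n + 1) q, gridRefl₂ (-1) q,
      gridReflρ (-1) q} :
      Finset (ℤ × ℤ)) : Set (ℤ × ℤ)) := by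
    subst hq
    ext p
    simp only [coverPoints, Set.mem_ofPred_eq, Finset.coe_insert, Finset.coe_singleton,
      Set.mem_insert_iff, Set.mem_singleton_iff]
    constructor
    · rintro ⟨hf, k, rfl | rfl | rfl⟩ <;>
        simp only [gridRefl₁_two, gridRefl₂_two, gridReflρ_two, sepCount_one, sepCount_two] at hf
      · obtain rfl | rfl : k = m + 1 ∨ k = -1 := by omega
        all_goals simp
      · obtain rfl | rfl : k = n + 1 ∨ k = -1 := by omega
        all_goals simp
      · obtain rfl : k = -1 := by omega
        simp
    · rintro (rfl | rfl | rfl | rfl | rfl)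
      all_goals
        refine ⟨?_, _, by tauto⟩
        simp only [gridRefl₁_two, gridRefl₂_two, gridReflρ_two, sepCount_one, sepCount_two]
        omega
  rw [h, Set.ncard_coe_finset]
  subst hq
  repeat rw [Finset.card_insert_of_notMem (by
    simp only [gridRefl₁_two, gridRefl₂_two, gridReflρ_two, Finset.mem_insert,
      Finset.mem_singleton, Prod.mk.injEq]
    omega)]
  simp

lemma ncard_coverPoints_simple_zero_thetaS (m n : ℕ) {q : ℤ × ℤ}
    (hq : q = (3 * (-n - 2 : ℤ) + 1, 3 * (-m - 2 : ℤ) + 1)) : (coverPoints q).ncard = 4 := by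
  have h : coverPoints q = (({gridRefl₁ 0 q, gridRefl₁ (-n - 2) q, gridRefl₂ 0 q, gridRefl₂ (-m - 2) q} :
      Finset (ℤ × ℤ)) : Set (ℤ × ℤ)) := by
    subst hq
    ext p
    simp only [coverPoints, Set.mem_ofPred_eq, Finset.coe_insert, Finset.coe_singleton,
      Set.mem_insert_iff, Set.mem_singleton_iff]
    constructor
    · rintro ⟨hf, k, rfl | rfl | rfl⟩ <;>
        simp only [gridRefl₁_one, gridRefl₂_one, gridReflρ_one, sepCount_one, sepCount_two] at hf
      · obtain rfl | rfl : k = 0 ∨ k = -n - 2 := by omega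
        all_goals simp
      · obtain rfl | rfl : k = 0 ∨ k = -m - 2 := by omega
        all_goals simp
      · omega
    · rintro (rfl | rfl | rfl | rfl)
      all_goals
        refine ⟨?_, _, by tauto⟩
        simp only [gridRefl₁_one, gridRefl₂_one, sepCount_one, sepCount_two]
        omega
  rw [h, Set.ncard_coe_finset]
  subst hq
  repeat rw [Finset.card_insert_of_notMem (by
    simp only [gridRefl₁_one, gridRefl₂_one, Finset.mem_insert,
      Finset.mem_singleton, Prod.mk.injEq]
    omega)]
  simp

/-- A Bruhat cover is obtained by a single reflection. -/
lemma mem_Uset_iff {B W : Type*} [Group W] {M : CoxeterMatrix B} (cs : CoxeterSystem M W)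
    (x w : W) :
    w ∈ Uset cs x ↔ (∃ t, cs.IsReflection t ∧ w = t * x) ∧ cs.length w = cs.length x + 1 := by
  have hlt : ∀ y, bruhatLT cs x y → cs.length x < cs.length y := fun y h ↦ by
    induction h with
    | single h => exact h.2
    | tail _ h ih => exact ih.trans h.2
  refine ⟨fun ⟨h, hl⟩ ↦ ⟨?_, hl⟩, fun ⟨h, hl⟩ ↦ ⟨.single ⟨h, by omega⟩, hl⟩⟩
  cases h with
  | single h => exact h.1
  | tail h h' =>
    have := hlt _ h
    have := h'.2
    omega

section Automorphisms

variable {B W : Type*} [Group W] {M : CoxeterMatrix B} (cs : CoxeterSystem M W)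

lemma MulEquiv.length_le_of_simple (φ : W ≃* W) (e : B → B)
    (he : ∀ i, φ (cs.simple i) = cs.simple (e i)) (w : W) : cs.length (φ w) ≤ cs.length w := by
  obtain ⟨ω, hω, rfl⟩ := cs.exists_isReduced w
  have : φ (cs.wordProd ω) = cs.wordProd (ω.map e) := by
    simp [CoxeterSystem.wordProd, map_list_prod, Function.comp_def, he]
  rw [this, hω.eq]
  simpa using cs.length_wordProd_le (ω.map e)

lemma MulEquiv.mem_Uset_iff_of_simple (φ : W ≃* W) (e : Equiv.Perm B)
    (he : ∀ i, φ (cs.simple i) = cs.simple (e i)) (x w : W) :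
    φ w ∈ Uset cs (φ x) ↔ w ∈ Uset cs x := by
  have he' : ∀ i, φ.symm (cs.simple i) = cs.simple (e.symm i) := fun i ↦ by
    rw [MulEquiv.symm_apply_eq, he, e.apply_symm_apply]
  have hl : ∀ w, cs.length (φ w) = cs.length w := fun w ↦
    le_antisymm (φ.length_le_of_simple cs e he w)
      (by simpa using φ.symm.length_le_of_simple cs e.symm he' (φ w))
  have hr : ∀ (ψ : W ≃* W) (f : B → B), (∀ i, ψ (cs.simple i) = cs.simple (f i)) →
      ∀ t, cs.IsReflection t → cs.IsReflection (ψ t) := by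
    rintro ψ f hf _ ⟨v, i, rfl⟩
    exact ⟨ψ v, f i, by simp [hf]⟩
  rw [mem_Uset_iff, mem_Uset_iff, hl, hl]
  refine and_congr_left fun _ ↦ ⟨?_, ?_⟩
  · rintro ⟨t, ht, h⟩
    exact ⟨φ.symm t, hr _ _ he' t ht, φ.injective (by simp [h])⟩
  · rintro ⟨t, ht, rfl⟩
    exact ⟨φ t, hr _ _ he t ht, by simp⟩

lemma inv_mem_Uset {x w : W} (h : w ∈ Uset cs x) : w⁻¹ ∈ Uset cs x⁻¹ := by
  rw [mem_Uset_iff] at h ⊢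
  obtain ⟨⟨t, ht, rfl⟩, hl⟩ := h
  refine ⟨⟨x⁻¹ * t * x, by simpa using ht.conj x⁻¹, ?_⟩, ?_⟩
  · simp [mul_assoc, ht.inv]
  · rwa [cs.length_inv, cs.length_inv]

end Automorphisms

lemma ncard_Uset_of_mem_Gsub {W : Type*} [Group W] {M : CoxeterMatrix (Fin 3)}
    (cs : CoxeterSystem M W) (dl sg : W ≃* W)
    (hdl : ∀ i : Fin 3, dl (cs.simple i) = cs.simple (i + 1))
    (hsg0 : sg (cs.simple 0) = cs.simple 0)
    (hsg1 : sg (cs.simple 1) = cs.simple 2)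
    (hsg2 : sg (cs.simple 2) = cs.simple 1)
    {g : Equiv.Perm W} (hg : g ∈ Gsub dl sg) (x : W) :
    (Uset cs (g x)).ncard = (Uset cs x).ncard := by
  have key : ∀ x w, g w ∈ Uset cs (g x) ↔ w ∈ Uset cs x := by
    induction hg using Subgroup.closure_induction with
    | mem g hg =>
      intro x w
      obtain rfl | rfl | rfl := hg
      · exact dl.mem_Uset_iff_of_simple cs (Equiv.addRight 1) (by simpa using hdl) x w
      · refine sg.mem_Uset_iff_of_simple cs (Equiv.swap 1 2) (fun i ↦ ?_) x w
        fin_cases i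
        · simpa [Equiv.swap_apply_of_ne_of_ne] using hsg0
        · simpa using hsg1
        · simpa using hsg2
      · exact ⟨fun h ↦ by simpa using inv_mem_Uset cs h, inv_mem_Uset cs⟩
    | one => simp
    | mul g h _ _ ihg ihh => intro x w; simp [ihg, ihh]
    | inv g _ ih => intro x w; rw [← ih]; simp
  have : Uset cs (g x) = g '' Uset cs x := by
    ext w
    rw [Equiv.image_eq_preimage_symm, Set.mem_preimage, ← key x, g.apply_symm_apply]
  rw [this, Set.ncard_image_of_injective _ g.injective]

section Action

variable {W : Type*} [Group W] {M : CoxeterMatrix (Fin 3)} {cs : CoxeterSystem M W}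
  {act : W →* Equiv.Perm E2}

lemma cen_mul (z w : W) : cen act (z * w) = act z (cen act w) := by
  simp [cen]

lemma cen_one : cen act 1 = gridPoint (-1, -1) := by
  ext <;> simp [cen, gridPoint, rho2] <;> norm_num

lemma cen_simple_mul
    (h0 : ∀ v, act (cs.simple 0) v = reflE rho2 (-1) v)
    (h1 : ∀ v, act (cs.simple 1) v = reflE a1 0 v)
    (h2 : ∀ v, act (cs.simple 2) v = reflE a2 0 v)
    {w : W} {q : ℤ × ℤ} (hw : cen act w = gridPoint q) (i : Fin 3) :
    cen act (cs.simple i * w) = gridPoint (gridSimple q i) := by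
  rw [cen_mul, hw]
  fin_cases i
  · simpa [gridSimple, h0] using reflE_rho2_gridPoint (-1) q
  · simpa [gridSimple, h1] using reflE_a1_gridPoint 0 q
  · simpa [gridSimple, h2] using reflE_a2_gridPoint 0 q

lemma exists_cen_eq_gridPoint
    (h0 : ∀ v, act (cs.simple 0) v = reflE rho2 (-1) v)
    (h1 : ∀ v, act (cs.simple 1) v = reflE a1 0 v)
    (h2 : ∀ v, act (cs.simple 2) v = reflE a2 0 v) (w : W) :
    ∃ q, cen act w = gridPoint q ∧ IsAlcovePoint q ∧ sepCount q ≤ cs.length w := by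
  induction h : cs.length w generalizing w with
  | zero =>
    rw [cs.length_eq_zero_iff.1 h]
    exact ⟨_, cen_one, ⟨-1, -1, by simp⟩, by simp [sepCount]⟩
  | succ n ih =>
    obtain ⟨i, hi⟩ := cs.exists_leftDescent_of_ne_one (w := w) (by rintro rfl; simp at h)
    have hl := (cs.isLeftDescent_iff).1 hi
    obtain ⟨q, hq, hA, hs⟩ := ih (cs.simple i * w) (by omega)
    have := cen_simple_mul h0 h1 h2 hq i
    rw [cs.simple_mul_simple_cancel_left] at this
    exact ⟨_, this, hA.gridSimple i, (hA.sepCount_gridSimple_le i).trans (by omega)⟩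

/-- The length of `w` is the number of lines separating its alcove from the fundamental one. -/
lemma length_eq_sepCount
    (h0 : ∀ v, act (cs.simple 0) v = reflE rho2 (-1) v)
    (h1 : ∀ v, act (cs.simple 1) v = reflE a1 0 v)
    (h2 : ∀ v, act (cs.simple 2) v = reflE a2 0 v)
    (hcen : Function.Injective (cen act)) {w : W} {q : ℤ × ℤ}
    (hw : cen act w = gridPoint q) : cs.length w = sepCount q := by
  obtain ⟨q', hq', hA, hs⟩ := exists_cen_eq_gridPoint h0 h1 h2 w
  obtain rfl : q = q' := gridPoint_injective (hw.symm.trans hq')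
  refine le_antisymm ?_ hs
  clear hs hq'
  induction h : sepCount q using Nat.strong_induction_on generalizing w q with
  | _ n ih =>
  subst h
  by_cases hq : q = (-1, -1)
  · rw [hcen (hw.trans (by rw [hq, cen_one])), cs.length_one]
    exact Nat.zero_le _
  obtain ⟨i, hi⟩ := hA.exists_sepCount_gridSimple_lt hq
  have := ih _ (by omega) (cen_simple_mul h0 h1 h2 hw i) (hA.gridSimple i) rfl
  rcases cs.length_simple_mul w i with h | h <;> omega

/-- Every reflection of `W` acts as an affine reflection `s_{α,k}`. -/
lemma act_of_isReflection
    (h0 : ∀ v, act (cs.simple 0) v = reflE rho2 (-1) v)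
    (h1 : ∀ v, act (cs.simple 1) v = reflE a1 0 v)
    (h2 : ∀ v, act (cs.simple 2) v = reflE a2 0 v)
    {t : W} (ht : cs.IsReflection t) :
    ∃ k : ℤ, (∀ v, act t v = reflE a1 k v) ∨ (∀ v, act t v = reflE a2 k v) ∨
      (∀ v, act t v = reflE rho2 k v) := by
  obtain ⟨w, i, rfl⟩ := ht
  induction w using cs.simple_induction_left with
  | one =>
    fin_cases i
    · exact ⟨-1, by simp [h0]⟩
    · exact ⟨0, by simp [h1]⟩
    · exact ⟨0, by simp [h2]⟩
  | mul_simple_left w j ih =>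
    have hj : ∀ v, act (cs.simple j * w * cs.simple i * (cs.simple j * w)⁻¹) v =
        act (cs.simple j) (act (w * cs.simple i * w⁻¹) (act (cs.simple j) v)) := fun v ↦ by
      rw [mul_inv_rev, cs.inv_simple]
      simp [mul_assoc]
    obtain ⟨k, h | h | h⟩ := ih <;> simp only [hj, h] <;> fin_cases j <;>
      simp only [Fin.zero_eta, Fin.mk_one, Fin.reduceFinMk, h0, h1, h2]
    · exact ⟨-1 - k, .inr (.inl fun v ↦ by ext <;> simp [reflE, B2, a1, a2, rho2] <;> ring)⟩
    · exact ⟨-k, .inl fun v ↦ by ext <;> simp [reflE, B2, a1] <;> ring⟩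
    · exact ⟨k, .inr (.inr fun v ↦ by ext <;> simp [reflE, B2, a1, a2, rho2] <;> ring)⟩
    · exact ⟨-1 - k, .inl fun v ↦ by ext <;> simp [reflE, B2, a1, a2, rho2] <;> ring⟩
    · exact ⟨k, .inr (.inr fun v ↦ by ext <;> simp [reflE, B2, a1, a2, rho2] <;> ring)⟩
    · exact ⟨-k, .inr (.inl fun v ↦ by ext <;> simp [reflE, B2, a2] <;> ring)⟩
    · exact ⟨-2 - k, .inr (.inr fun v ↦ by ext <;> simp [reflE, B2, rho2] <;> ring)⟩
    · exact ⟨k, .inr (.inl fun v ↦ by ext <;> simp [reflE, B2, a1, a2, rho2] <;> ring)⟩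
    · exact ⟨k, .inl fun v ↦ by ext <;> simp [reflE, B2, a1, a2, rho2] <;> ring⟩

lemma exists_isReflection_conj {a b c : E2} {i : Fin 3} {j k l : ℝ}
    (hi : ∀ v, act (cs.simple i) v = reflE a j v)
    (h : ∃ t, cs.IsReflection t ∧ ∀ v, act t v = reflE b k v)
    (hc : ∀ v, reflE a j (reflE b k (reflE a j v)) = reflE c l v) :
    ∃ t, cs.IsReflection t ∧ ∀ v, act t v = reflE c l v := by
  obtain ⟨t, ht, h⟩ := h
  refine ⟨_, ht.conj (cs.simple i), fun v ↦ ?_⟩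
  rw [cs.inv_simple, map_mul, map_mul, Equiv.Perm.mul_apply, Equiv.Perm.mul_apply, hi, hi, h, hc]

lemma exists_isReflection_a1
    (h0 : ∀ v, act (cs.simple 0) v = reflE rho2 (-1) v)
    (h1 : ∀ v, act (cs.simple 1) v = reflE a1 0 v)
    (h2 : ∀ v, act (cs.simple 2) v = reflE a2 0 v) (k : ℤ) :
    ∃ t, cs.IsReflection t ∧ ∀ v, act t v = reflE a1 k v := by
  have neg : ∀ k : ℝ, (∃ t, cs.IsReflection t ∧ ∀ v, act t v = reflE a1 k v) →
      ∃ t, cs.IsReflection t ∧ ∀ v, act t v = reflE a1 (-k) v := fun k h ↦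
    exists_isReflection_conj h1 h fun v ↦ by ext <;> simp [reflE, B2, a1] <;> ring
  have flip : ∀ k : ℝ, (∃ t, cs.IsReflection t ∧ ∀ v, act t v = reflE a1 k v) →
      ∃ t, cs.IsReflection t ∧ ∀ v, act t v = reflE a1 (-1 - k) v := fun k h ↦ by
    have h' : ∃ t, cs.IsReflection t ∧ ∀ v, act t v = reflE a2 (-1 - k) v :=
      exists_isReflection_conj h0 h fun v ↦ by ext <;> simp [reflE, B2, a1, a2, rho2] <;> ring
    have h'' : ∃ t, cs.IsReflection t ∧ ∀ v, act t v = reflE rho2 (-1 - k) v :=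
      exists_isReflection_conj h1 h' fun v ↦ by ext <;> simp [reflE, B2, a1, a2, rho2] <;> ring
    exact exists_isReflection_conj h2 h'' fun v ↦ by
      ext <;> simp [reflE, B2, a1, a2, rho2] <;> ring
  induction k using Int.induction_on with
  | zero => exact ⟨_, cs.isReflection_simple 1, by simpa using h1⟩
  | succ k ih =>
    have : ((k + 1 : ℤ) : ℝ) = -(-1 - (k : ℤ)) := by push_cast; ring
    exact this ▸ neg _ (flip _ ih)
  | pred k ih =>
    have : ((-k - 1 : ℤ) : ℝ) = -1 - -((-k : ℤ) : ℝ) := by push_cast; ring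
    exact this ▸ flip _ (neg _ ih)

lemma exists_isReflection_rho2
    (h0 : ∀ v, act (cs.simple 0) v = reflE rho2 (-1) v)
    (h1 : ∀ v, act (cs.simple 1) v = reflE a1 0 v)
    (h2 : ∀ v, act (cs.simple 2) v = reflE a2 0 v) (k : ℤ) :
    ∃ t, cs.IsReflection t ∧ ∀ v, act t v = reflE rho2 k v :=
  exists_isReflection_conj h2 (exists_isReflection_a1 h0 h1 h2 k) fun v ↦ by
    ext <;> simp [reflE, B2, a1, a2, rho2] <;> ring

lemma exists_isReflection_a2
    (h0 : ∀ v, act (cs.simple 0) v = reflE rho2 (-1) v)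
    (h1 : ∀ v, act (cs.simple 1) v = reflE a1 0 v)
    (h2 : ∀ v, act (cs.simple 2) v = reflE a2 0 v) (k : ℤ) :
    ∃ t, cs.IsReflection t ∧ ∀ v, act t v = reflE a2 k v :=
  exists_isReflection_conj h1 (exists_isReflection_rho2 h0 h1 h2 k) fun v ↦ by
    ext <;> simp [reflE, B2, a1, a2, rho2] <;> ring

lemma ncard_Uset_eq
    (h0 : ∀ v, act (cs.simple 0) v = reflE rho2 (-1) v)
    (h1 : ∀ v, act (cs.simple 1) v = reflE a1 0 v)
    (h2 : ∀ v, act (cs.simple 2) v = reflE a2 0 v)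
    (hcen : Function.Injective (cen act)) {x : W} {q : ℤ × ℤ}
    (hx : cen act x = gridPoint q) : (Uset cs x).ncard = (coverPoints q).ncard := by
  have hlen := @length_eq_sepCount W _ M cs act h0 h1 h2 hcen
  have himage : cen act '' Uset cs x = gridPoint '' coverPoints q := by
    ext v
    constructor
    · rintro ⟨w, hw, rfl⟩
      obtain ⟨⟨t, ht, rfl⟩, hl⟩ := (mem_Uset_iff cs x w).1 hw
      have hp : ∀ p, cen act (t * x) = gridPoint p → sepCount p = sepCount q + 1 := fun p hp ↦ by
        rw [← hlen hp, hl, hlen hx]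
      obtain ⟨k, h | h | h⟩ := act_of_isReflection h0 h1 h2 ht
      · have := (cen_mul t x).trans ((congrArg _ hx).trans
          ((h _).trans (reflE_a1_gridPoint k q)))
        exact ⟨_, ⟨hp _ this, k, .inl rfl⟩, this.symm⟩
      · have := (cen_mul t x).trans ((congrArg _ hx).trans
          ((h _).trans (reflE_a2_gridPoint k q)))
        exact ⟨_, ⟨hp _ this, k, .inr (.inl rfl)⟩, this.symm⟩
      · have := (cen_mul t x).trans ((congrArg _ hx).trans
          ((h _).trans (reflE_rho2_gridPoint k q)))
        exact ⟨_, ⟨hp _ this, k, .inr (.inr rfl)⟩, this.symm⟩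
    · rintro ⟨p, ⟨hp, k, hk⟩, rfl⟩
      obtain ⟨t, ht, h⟩ : ∃ t, cs.IsReflection t ∧ act t (gridPoint q) = gridPoint p := by
        obtain rfl | rfl | rfl := hk
        · obtain ⟨t, ht, h⟩ := exists_isReflection_a1 h0 h1 h2 k
          exact ⟨t, ht, by rw [h, reflE_a1_gridPoint]⟩
        · obtain ⟨t, ht, h⟩ := exists_isReflection_a2 h0 h1 h2 k
          exact ⟨t, ht, by rw [h, reflE_a2_gridPoint]⟩
        · obtain ⟨t, ht, h⟩ := exists_isReflection_rho2 h0 h1 h2 k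
          exact ⟨t, ht, by rw [h, reflE_rho2_gridPoint]⟩
      have hc : cen act (t * x) = gridPoint p := by rw [cen_mul, hx, h]
      exact ⟨t * x, (mem_Uset_iff cs x _).2 ⟨⟨t, ht, rfl⟩, by rw [hlen hc, hlen hx, hp]⟩, hc⟩
  rw [← Set.ncard_image_of_injective _ hcen, himage,
    Set.ncard_image_of_injective _ gridPoint_injective]

end Action

/-- the number of Bruhat covers of `x` according to the part of the
`XΘ`-partition containing `x`. -/
theorem statement2
    {W : Type*} [Group W] {M : CoxeterMatrix (Fin 3)} (cs : CoxeterSystem M W)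
    (hM : ∀ i j : Fin 3, M i j = if i = j then 1 else 3)
    (act : W →* Equiv.Perm E2)
    (h0 : ∀ v, act (cs.simple 0) v = reflE rho2 (-1) v)
    (h1 : ∀ v, act (cs.simple 1) v = reflE a1 0 v)
    (h2 : ∀ v, act (cs.simple 2) v = reflE a2 0 v)
    (hcen : Function.Injective (cen act))
    (th ths : ℕ → ℕ → W)
    (hth : ∀ m n : ℕ, cen act (th m n) =
      cen act (cs.simple 1 * cs.simple 2 * cs.simple 1) + (m : ℝ) • fw1 + (n : ℝ) • fw2)
    (hths : ∀ m n : ℕ, cen act (ths m n) =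
      cen act 1 + ((m : ℝ) + 1) • fw1 + ((n : ℝ) + 1) • fw2)
    (dl sg : W ≃* W)
    (hdl : ∀ i : Fin 3, dl (cs.simple i) = cs.simple (i + 1))
    (hsg0 : sg (cs.simple 0) = cs.simple 0)
    (hsg1 : sg (cs.simple 1) = cs.simple 2)
    (hsg2 : sg (cs.simple 2) = cs.simple 1)
    (x : W) (hx1 : x ≠ 1)
    (hxX : x ∉ {w : W | ∃ k : ℕ, 1 ≤ k ∧ ∃ g ∈ Gsub dl sg, w = g (xelt cs k)}) :
    (x ∈ {w : W | ∃ m n : ℕ, ∃ g ∈ Gsub dl sg, w = g (th m n)} → (Uset cs x).ncard = 6) ∧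
    (x ∈ {w : W | ∃ m n : ℕ, ∃ g ∈ Gsub dl sg, w = g (ths m n)} → (Uset cs x).ncard = 5) ∧
    (x ∈ {w : W | ∃ m n : ℕ, ∃ g ∈ Gsub dl sg, w = g (cs.simple 0 * ths m n)} →
      (Uset cs x).ncard = 4) := by
  have hG := @ncard_Uset_of_mem_Gsub W _ M cs dl sg hdl hsg0 hsg1 hsg2
  have hS : ∀ m n, cen act (ths m n) = gridPoint (3 * (m : ℤ) + 2, 3 * (n : ℤ) + 2) := fun m n ↦ by
    rw [hths, cen_one]
    ext <;> simp [gridPoint, fw1, fw2] <;> ring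
  refine ⟨?_, ?_, ?_⟩ <;> rintro ⟨m, n, g, hg, rfl⟩ <;> rw [hG hg]
  · rw [ncard_Uset_eq h0 h1 h2 hcen (q := (3 * (m : ℤ) + 1, 3 * (n : ℤ) + 1)),
      ncard_coverPoints_theta m n rfl]
    rw [hth, mul_assoc, cen_mul, cen_mul, cen, h1, h1, h2]
    ext <;> simp [gridPoint, fw1, fw2, reflE, B2, a1, a2, rho2] <;> ring
  · rw [ncard_Uset_eq h0 h1 h2 hcen (hS m n), ncard_coverPoints_thetaS m n rfl]
  · rw [ncard_Uset_eq h0 h1 h2 hcen (q := (3 * (-n - 2 : ℤ) + 1, 3 * (-m - 2 : ℤ) + 1)),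
      ncard_coverPoints_simple_zero_thetaS m n rfl]
    rw [cen_simple_mul h0 h1 h2 (hS m n)]
    congr 1
    simp [gridSimple, gridReflρ_two]
    constructor <;> ring
end
end

section
/- The cardinalities of the lower Bruhat intervals of W are given by the following exact formulas. For all integers m, n ≥ 0: |[e, θ(m,n)]| = 3m² + 3n² + 12mn + 9m + 9n + 6; |[e, θ^s(m,n)]| = 3m² + 3n² + 12mn + 15m + 15n + 12; |[e, s0·θ^s(m,n)]| = 3m² + 3n² + 12mn + 21m + 21n + 22. Moreover, for every integer k ≥ 1: |[e, x_{2k}]| = 3k² + k and |[e, x_{2k+1}]| = 3k² + 5k. -/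
noncomputable section

open scoped RealInnerProductSpace

namespace CoxeterSystem

section StrongExchange

variable {B W : Type*} [Group W] {M : CoxeterMatrix B} (cs : CoxeterSystem M W)

open Classical in
/-- The action of a simple reflection on `W × ℤ/2`: conjugation on `W`, together with a change of
sign at the simple reflection itself. -/
def signedConj (i : B) : Equiv.Perm (W × ZMod 2) :=
  Function.Involutive.toPerm
    (fun p => (cs.simple i * p.1 * cs.simple i, p.2 + if p.1 = cs.simple i then 1 else 0)) <| by
    rintro ⟨w, e⟩
    have h : cs.simple i * w * cs.simple i = cs.simple i ↔ w = cs.simple i := by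
      constructor
      · intro h
        have h' := congrArg (cs.simple i * · * cs.simple i) h
        simpa [mul_assoc] using h'
      · rintro rfl
        simp
    ext
    · simp [mul_assoc]
    · simp only [h, add_assoc, CharTwo.add_self_eq_zero, add_zero]

open Classical in
theorem signedConj_apply (i : B) (w : W) (e : ZMod 2) :
    cs.signedConj i (w, e) =
      (cs.simple i * w * cs.simple i, e + if w = cs.simple i then 1 else 0) := rfl

open Classical in
theorem signedConj_mul_pow_apply (i j : B) (k : ℕ) (w : W) (e : ZMod 2) :
    ((cs.signedConj i * cs.signedConj j) ^ k) (w, e) =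
      ((cs.simple i * cs.simple j) ^ k * w * (cs.simple j * cs.simple i) ^ k,
        e + ∑ l ∈ Finset.range (2 * k),
          if w = (cs.simple j * cs.simple i) ^ l * cs.simple j then 1 else 0) := by
  induction k with
  | zero => simp
  | succ k ih =>
    have shift : cs.simple j * (cs.simple i * cs.simple j) ^ k
        = (cs.simple j * cs.simple i) ^ k * cs.simple j :=
      (SemiconjBy.pow_right (a := cs.simple j) (x := cs.simple i * cs.simple j)
        (y := cs.simple j * cs.simple i) (by simp [SemiconjBy, mul_assoc]) k)
    have conj_eq (u : W) : (cs.simple i * cs.simple j) ^ k * w * (cs.simple j * cs.simple i) ^ k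
        = u ↔ w = (cs.simple j * cs.simple i) ^ k * u * (cs.simple i * cs.simple j) ^ k := by
      have h : (cs.simple i * cs.simple j) ^ k = ((cs.simple j * cs.simple i) ^ k)⁻¹ := by
        simp [← inv_pow]
      rw [h]
      constructor
      · rintro rfl; group
      · rintro rfl; group
    have conj_eq' (u : W) : cs.simple j * u * cs.simple j = cs.simple i ↔
        u = cs.simple j * cs.simple i * cs.simple j := by
      constructor
      · rintro h; simp [← h, mul_assoc]
      · rintro rfl; simp [mul_assoc]
    rw [pow_succ', Equiv.Perm.mul_apply, ih, Equiv.Perm.mul_apply, signedConj_apply,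
      signedConj_apply]
    simp only [Prod.mk.injEq]
    refine ⟨by rw [pow_succ', pow_succ]; simp only [mul_assoc], ?_⟩
    rw [show 2 * (k + 1) = 2 * k + 1 + 1 by ring, Finset.sum_range_succ, Finset.sum_range_succ,
      ← add_assoc, ← add_assoc]
    congr 2
    · rw [conj_eq, mul_assoc, shift, two_mul, pow_add, mul_assoc]
    · rw [conj_eq', conj_eq, mul_assoc, mul_assoc (cs.simple j * cs.simple i), shift,
        ← mul_assoc (cs.simple j * cs.simple i), ← pow_succ', ← mul_assoc, ← pow_add,
        ← add_assoc, ← two_mul]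

theorem isLiftable_signedConj : M.IsLiftable cs.signedConj := by
  classical
  intro i j
  ext1 ⟨w, e⟩
  rw [signedConj_mul_pow_apply, two_mul, Finset.sum_range_add]
  have h : (cs.simple j * cs.simple i) ^ M i j = 1 := cs.simple_mul_simple_pow' i j
  simp [pow_add, h, CharTwo.add_self_eq_zero]

/-- The action of `W` on `W × ℤ/2` extending the action of the simple reflections. -/
def signedConjHom : W →* Equiv.Perm (W × ZMod 2) :=
  cs.lift ⟨cs.signedConj, cs.isLiftable_signedConj⟩

theorem signedConjHom_simple (i : B) : cs.signedConjHom (cs.simple i) = cs.signedConj i :=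
  cs.lift_apply_simple _ i

open Classical in
theorem signedConjHom_wordProd_apply (ω : List B) (w : W) (e : ZMod 2) :
    cs.signedConjHom (cs.wordProd ω) (w, e) =
      (cs.wordProd ω * w * (cs.wordProd ω)⁻¹, e + (cs.rightInvSeq ω).count w) := by
  induction ω with
  | nil => simp
  | cons i ω ih =>
    have h : cs.wordProd ω * w * (cs.wordProd ω)⁻¹ = cs.simple i ↔
        (cs.wordProd ω)⁻¹ * cs.simple i * cs.wordProd ω = w := by
      constructor
      · intro h; rw [← h]; group
      · rintro rfl; group
    rw [wordProd_cons, map_mul, Equiv.Perm.mul_apply, ih, signedConjHom_simple, signedConj_apply,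
      rightInvSeq, List.count_cons]
    simp only [Prod.mk.injEq, mul_inv_rev, inv_simple, mul_assoc, true_and] at h ⊢
    simp only [h, beq_iff_eq, Nat.cast_add, Nat.cast_ite, Nat.cast_one, Nat.cast_zero, add_assoc]

/-- The parity of the number of occurrences of `t` in the right inversion sequence of any word
for `w`. -/
def inversionParity (w t : W) : ZMod 2 := (cs.signedConjHom w (t, 0)).2

theorem signedConjHom_apply (w t : W) (e : ZMod 2) :
    cs.signedConjHom w (t, e) = (w * t * w⁻¹, e + cs.inversionParity w t) := by
  obtain ⟨ω, rfl⟩ := cs.wordProd_surjective w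
  simp [inversionParity, signedConjHom_wordProd_apply]

theorem inversionParity_mul (u w t : W) :
    cs.inversionParity (u * w) t =
      cs.inversionParity w t + cs.inversionParity u (w * t * w⁻¹) := by
  rw [inversionParity, map_mul, Equiv.Perm.mul_apply, signedConjHom_apply, signedConjHom_apply]
  simp

open Classical in
theorem inversionParity_simple (i : B) (t : W) :
    cs.inversionParity (cs.simple i) t = if t = cs.simple i then 1 else 0 := by
  simp [inversionParity, signedConjHom_simple, signedConj_apply]

theorem inversionParity_one (t : W) : cs.inversionParity 1 t = 0 := by
  simp [inversionParity]

theorem IsReflection.inversionParity_self {t : W} (ht : cs.IsReflection t) :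
    cs.inversionParity t t = 1 := by
  obtain ⟨w, i, rfl⟩ := ht
  have h := cs.inversionParity_mul w⁻¹ w (cs.simple i)
  have e : w⁻¹ * (w * cs.simple i * w⁻¹) * w⁻¹⁻¹ = cs.simple i := by group
  rw [inv_mul_cancel, inversionParity_one] at h
  rw [inversionParity_mul, inversionParity_mul, inversionParity_simple, e, if_pos rfl, inv_simple,
    simple_mul_simple_self, one_mul]
  linear_combination -h

theorem isRightInversion_iff_inversionParity {w t : W} (ht : cs.IsReflection t) :
    cs.IsRightInversion w t ↔ cs.inversionParity w t = 1 := by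
  classical
  have of_parity (u : W) (hu : cs.inversionParity u t = 1) : cs.IsRightInversion u t := by
    obtain ⟨ω, hω, rfl⟩ := cs.exists_isReduced u
    refine cs.isRightInversion_of_mem_rightInvSeq hω ?_
    by_contra hmem
    rw [inversionParity, signedConjHom_wordProd_apply, List.count_eq_zero_of_not_mem hmem] at hu
    simp at hu
  refine ⟨fun hw => ?_, of_parity w⟩
  by_contra h
  have h0 : cs.inversionParity w t = 0 := by
    generalize cs.inversionParity w t = a at h
    revert a; decide
  have := of_parity (w * t) (by
    rw [inversionParity_mul, ht.inversionParity_self, mul_inv_cancel_right, h0, add_zero])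
  exact (IsReflection.isRightInversion_mul_left_iff ht).mp this hw

/-- If a reflection is a right inversion of `s w` but not of `w`, then it is `w⁻¹ s w`. -/
theorem simple_mul_eq_mul_of_isRightInversion {w t : W} {i : B}
    (h : cs.IsRightInversion (cs.simple i * w) t) (h' : ¬ cs.IsRightInversion w t) :
    cs.simple i * w = w * t := by
  classical
  have ht := h.1
  rw [isRightInversion_iff_inversionParity cs ht, inversionParity_mul,
    inversionParity_simple] at h
  rw [isRightInversion_iff_inversionParity cs ht] at h'
  split_ifs at h with hc
  · rw [← hc]; group
  · exact absurd (by simpa using h) h'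

end StrongExchange

end CoxeterSystem

section BruhatOrder

variable {B W : Type*} [Group W] {M : CoxeterMatrix B} (cs : CoxeterSystem M W)

theorem bruhatLE_refl (x : W) : bruhatLE cs x x := Or.inl rfl

theorem bruhatLE_iff_reflTransGen {x y : W} : bruhatLE cs x y ↔
    Relation.ReflTransGen
      (fun a b => (∃ t, cs.IsReflection t ∧ b = t * a) ∧ cs.length a < cs.length b) x y := by
  rw [Relation.reflTransGen_iff_eq_or_transGen, eq_comm]
  rfl

theorem bruhatLE_trans {x y z : W} (h : bruhatLE cs x y) (h' : bruhatLE cs y z) :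
    bruhatLE cs x z := by
  rw [bruhatLE_iff_reflTransGen] at *
  exact h.trans h'

theorem bruhatLE_of_reflection_mul {x t : W} (ht : cs.IsReflection t)
    (h : cs.length x < cs.length (t * x)) : bruhatLE cs x (t * x) :=
  Or.inr (.single ⟨⟨t, ht, rfl⟩, h⟩)

theorem length_le_of_bruhatLE {x y : W} (h : bruhatLE cs x y) : cs.length x ≤ cs.length y := by
  rw [bruhatLE_iff_reflTransGen] at h
  induction h with
  | refl => exact le_rfl
  | tail _ h ih => exact ih.trans h.2.le

theorem bruhatLE_one_iff {x : W} : bruhatLE cs x 1 ↔ x = 1 := by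
  refine ⟨fun h => ?_, fun h => h ▸ bruhatLE_refl cs _⟩
  simpa using length_le_of_bruhatLE cs h

theorem bruhatLE_inv {x y : W} (h : bruhatLE cs x y) : bruhatLE cs x⁻¹ y⁻¹ := by
  rw [bruhatLE_iff_reflTransGen] at h ⊢
  refine Relation.ReflTransGen.lift (·⁻¹) ?_ _ _ h
  rintro a _ ⟨⟨t, ht, rfl⟩, hl⟩
  refine ⟨⟨a⁻¹ * t * a, ?_, ?_⟩, by simpa only [cs.length_inv] using hl⟩
  · simpa using ht.conj a⁻¹
  · simp [mul_assoc, ht.inv]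

theorem bruhatLE_inv_iff {x y : W} : bruhatLE cs x⁻¹ y⁻¹ ↔ bruhatLE cs x y :=
  ⟨fun h => by simpa using bruhatLE_inv cs h, bruhatLE_inv cs⟩

/-- Left multiplication by a simple reflection either reverses a step of the Bruhat order, in which
case it exchanges the two ends, or preserves it. -/
theorem simple_mul_eq_or_bruhatLE {x t : W} (ht : cs.IsReflection t) (i : B)
    (h : cs.length x < cs.length (t * x)) :
    cs.simple i * x = t * x ∨ bruhatLE cs (cs.simple i * x) (cs.simple i * (t * x)) := by
  have ht' : cs.IsReflection (x⁻¹ * t * x) := by simpa using ht.conj x⁻¹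
  have hs : cs.IsReflection (cs.simple i * t * (cs.simple i)⁻¹) := ht.conj _
  have e : cs.simple i * (t * x) = cs.simple i * t * (cs.simple i)⁻¹ * (cs.simple i * x) := by
    group
  by_cases hlt : cs.length (cs.simple i * x) < cs.length (cs.simple i * (t * x))
  · right
    rw [e] at hlt ⊢
    exact bruhatLE_of_reflection_mul cs hs hlt
  · left
    have hne := hs.length_mul_right_ne (cs.simple i * x)
    rw [← e] at hne
    have hmul : t * x * (x⁻¹ * t * x) = x := by
      have := ht.mul_self
      simp [← mul_assoc, this]
    have key := cs.simple_mul_eq_mul_of_isRightInversion (w := cs.simple i * (t * x))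
      (t := x⁻¹ * t * x) (i := i)
      ⟨ht', by rw [cs.simple_mul_simple_cancel_left, hmul]; exact h⟩
      (fun hinv => by
        have := hinv.2
        rw [mul_assoc, hmul] at this
        omega)
    rw [cs.simple_mul_simple_cancel_left, mul_assoc, hmul] at key
    exact key.symm

theorem simple_mul_bruhatLE_or {x y : W} (i : B) (h : bruhatLE cs x y) :
    bruhatLE cs (cs.simple i * x) y ∨ bruhatLE cs (cs.simple i * x) (cs.simple i * y) := by
  rw [bruhatLE_iff_reflTransGen] at h
  induction h using Relation.ReflTransGen.head_induction_on with
  | refl => exact Or.inr (bruhatLE_refl cs _)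
  | head hstep hrest ih =>
    obtain ⟨⟨t, ht, rfl⟩, hl⟩ := hstep
    rcases simple_mul_eq_or_bruhatLE cs ht i hl with h | h
    · exact Or.inl (h ▸ (bruhatLE_iff_reflTransGen cs).2 hrest)
    · exact ih.imp (bruhatLE_trans cs h) (bruhatLE_trans cs h)

theorem bruhatLE_simple_mul_or {x y : W} (i : B) (h : bruhatLE cs x y) :
    bruhatLE cs x (cs.simple i * y) ∨ bruhatLE cs (cs.simple i * x) (cs.simple i * y) := by
  rw [bruhatLE_iff_reflTransGen] at h
  induction h with
  | refl => exact Or.inr (bruhatLE_refl cs _)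
  | tail hrest hstep ih =>
    obtain ⟨⟨t, ht, rfl⟩, hl⟩ := hstep
    rcases simple_mul_eq_or_bruhatLE cs ht i hl with h | h
    · left
      rw [← h, cs.simple_mul_simple_cancel_left]
      exact (bruhatLE_iff_reflTransGen cs).2 hrest
    · exact ih.imp (bruhatLE_trans cs · h) (bruhatLE_trans cs · h)

/-- The lifting property: lower intervals grow under left multiplication by a simple reflection. -/
theorem bruhatLE_simple_mul_iff {y : W} {i : B} (hy : ¬ bruhatLE cs (cs.simple i * y) y) (z : W) :
    bruhatLE cs z (cs.simple i * y) ↔ bruhatLE cs z y ∨ bruhatLE cs (cs.simple i * z) y := by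
  have hi := cs.isReflection_simple i
  have hlt : cs.length y < cs.length (cs.simple i * y) := by
    by_contra h
    have hne := cs.length_simple_mul_ne y i
    refine hy ?_
    have := bruhatLE_of_reflection_mul cs hi (x := cs.simple i * y)
      (by rw [cs.simple_mul_simple_cancel_left]; omega)
    rwa [cs.simple_mul_simple_cancel_left] at this
  have hle := bruhatLE_of_reflection_mul cs hi hlt
  constructor
  · intro h
    simpa using bruhatLE_simple_mul_or cs i h
  · rintro (h | h)
    · exact bruhatLE_trans cs h hle
    · have := simple_mul_bruhatLE_or cs i h
      rw [cs.simple_mul_simple_cancel_left] at this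
      exact this.elim (bruhatLE_trans cs · hle) id

theorem bruhatLE_mul_simple_iff {y : W} {i : B} (hy : ¬ bruhatLE cs (y * cs.simple i) y) (z : W) :
    bruhatLE cs z (y * cs.simple i) ↔ bruhatLE cs z y ∨ bruhatLE cs (z * cs.simple i) y := by
  have h := bruhatLE_simple_mul_iff cs (y := y⁻¹) (i := i)
    (by rw [← bruhatLE_inv_iff] at hy; simpa using hy) z⁻¹
  rw [← bruhatLE_inv_iff cs (x := z), ← bruhatLE_inv_iff cs (x := z),
    ← bruhatLE_inv_iff cs (x := z * _)]
  simpa using h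

end BruhatOrder

section Alcoves

/-- The integer triples that encode alcoves: the coordinates of the tripled barycenters, whose sum
is zero and whose residues modulo three are pairwise distinct. -/
def IsAlcove (p : ℤ × ℤ × ℤ) : Prop :=
  p.1 + p.2.1 + p.2.2 = 0 ∧ p.1 % 3 ≠ p.2.1 % 3 ∧ p.2.1 % 3 ≠ p.2.2 % 3 ∧ p.1 % 3 ≠ p.2.2 % 3

/-- The barycenter of the alcove encoded by a triple. -/
def alcoveCenter (p : ℤ × ℤ × ℤ) : E2 := ((p.1 : ℝ) / 3, -(p.2.2 : ℝ) / 3)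

/-- The involution of `ℤ` exchanging `k` and `k + 1` for all `k` congruent to `r` modulo three. -/
def residueSwap (r e : ℤ) : ℤ :=
  if (e - r) % 3 = 0 then e + 1 else if (e - r) % 3 = 1 then e - 1 else e

/-- The alcove adjacent to a given one across the wall of type `r`. -/
def adjacentAlcove (r : ℤ) (p : ℤ × ℤ × ℤ) : ℤ × ℤ × ℤ :=
  (residueSwap r p.1, residueSwap r p.2.1, residueSwap r p.2.2)

/-- The action of the simple reflections on alcoves. -/
def reflectAlcove : Fin 3 → ℤ × ℤ × ℤ → ℤ × ℤ × ℤ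
  | 0, p => (p.2.2 - 3, p.2.1, p.1 + 3)
  | 1, p => (p.2.1, p.1, p.2.2)
  | 2, p => (p.1, p.2.2, p.2.1)

theorem residueSwap_sub_three (r e : ℤ) : residueSwap r (e - 3) = residueSwap r e - 3 := by
  unfold residueSwap
  split_ifs <;> omega

theorem residueSwap_add_three (r e : ℤ) : residueSwap r (e + 3) = residueSwap r e + 3 := by
  unfold residueSwap
  split_ifs <;> omega

theorem reflectAlcove_adjacentAlcove (i : Fin 3) (r : ℤ) (p : ℤ × ℤ × ℤ) :
    reflectAlcove i (adjacentAlcove r p) = adjacentAlcove r (reflectAlcove i p) := by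
  fin_cases i <;> simp [reflectAlcove, adjacentAlcove, residueSwap_sub_three, residueSwap_add_three]

theorem IsAlcove.reflectAlcove {p : ℤ × ℤ × ℤ} (hp : IsAlcove p) (i : Fin 3) :
    IsAlcove (reflectAlcove i p) := by
  unfold IsAlcove at *
  fin_cases i <;> simp only [_root_.reflectAlcove] <;> omega

theorem IsAlcove.adjacentAlcove {p : ℤ × ℤ × ℤ} (hp : IsAlcove p) (r : ℤ) :
    IsAlcove (adjacentAlcove r p) := by
  unfold IsAlcove at *
  simp only [_root_.adjacentAlcove, residueSwap]
  split_ifs <;> omega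

theorem alcoveCenter_injOn {p q : ℤ × ℤ × ℤ} (hp : p.1 + p.2.1 + p.2.2 = 0)
    (hq : q.1 + q.2.1 + q.2.2 = 0) (h : alcoveCenter p = alcoveCenter q) : p = q := by
  simp only [alcoveCenter, Prod.mk.injEq] at h
  have h1 : (p.1 : ℝ) = q.1 := by linarith [h.1]
  have h2 : (p.2.2 : ℝ) = q.2.2 := by linarith [h.2]
  norm_cast at h1 h2
  ext <;> omega

/-- The conditions under which `crd` is the labelling of the elements of the affine Weyl group by
alcoves. -/
structure IsAlcoveLabelling {W : Type*} [Group W] {M : CoxeterMatrix (Fin 3)}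
    (cs : CoxeterSystem M W) (crd : W → ℤ × ℤ × ℤ) : Prop where
  injective : Function.Injective crd
  isAlcove : ∀ w, IsAlcove (crd w)
  one : crd 1 = (-1, 0, 1)
  mul_simple : ∀ w i, crd (w * cs.simple i) = adjacentAlcove ((i : ℕ) + 1) (crd w)
  simple_mul : ∀ w i, crd (cs.simple i * w) = reflectAlcove i (crd w)

theorem exists_isAlcoveLabelling {W : Type*} [Group W] {M : CoxeterMatrix (Fin 3)}
    (cs : CoxeterSystem M W) (act : W →* Equiv.Perm E2)
    (h0 : ∀ v, act (cs.simple 0) v = reflE rho2 (-1) v)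
    (h1 : ∀ v, act (cs.simple 1) v = reflE a1 0 v)
    (h2 : ∀ v, act (cs.simple 2) v = reflE a2 0 v)
    (hcen : Function.Injective (cen act)) :
    ∃ crd : W → ℤ × ℤ × ℤ, IsAlcoveLabelling cs crd ∧
      ∀ w, cen act w = alcoveCenter (crd w) := by
  have act_center (i : Fin 3) (p : ℤ × ℤ × ℤ) (hp : p.1 + p.2.1 + p.2.2 = 0) :
      act (cs.simple i) (alcoveCenter p) = alcoveCenter (reflectAlcove i p) := by
    have hp' : (p.1 : ℝ) + p.2.1 + p.2.2 = 0 := by exact_mod_cast hp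
    fin_cases i
    · ext <;> simp [h0, reflE, B2, rho2, alcoveCenter, reflectAlcove] <;> linarith
    · ext <;> simp [h1, reflE, B2, a1, alcoveCenter, reflectAlcove]
      linarith
    · ext <;> simp [h2, reflE, B2, a2, alcoveCenter, reflectAlcove]
      linarith
  have cen_mul (u w : W) : cen act (u * w) = act u (cen act w) := by simp [cen]
  have cen_one : cen act 1 = alcoveCenter (-1, 0, 1) := by
    ext <;> simp [cen, alcoveCenter, rho2] <;> norm_num
  have exists_label (w : W) : ∃ p, IsAlcove p ∧ cen act w = alcoveCenter p ∧
      ∀ i : Fin 3, cen act (w * cs.simple i) = alcoveCenter (adjacentAlcove ((i : ℕ) + 1) p) := by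
    induction w using cs.simple_induction_left with
    | one =>
      refine ⟨(-1, 0, 1), by norm_num [IsAlcove], cen_one, fun i => ?_⟩
      rw [one_mul, ← mul_one (cs.simple i), cen_mul, cen_one, act_center _ _ (by norm_num)]
      congr 1
      fin_cases i <;> decide
    | mul_simple_left w i ih =>
      obtain ⟨p, hp, hw, hws⟩ := ih
      refine ⟨reflectAlcove i p, hp.reflectAlcove i, ?_, fun j => ?_⟩
      · rw [cen_mul, hw, act_center _ _ hp.1]
      · rw [mul_assoc, cen_mul, hws, act_center _ _ (hp.adjacentAlcove _).1,
          reflectAlcove_adjacentAlcove]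
  choose crd hcrd hw hws using exists_label
  refine ⟨crd, ⟨fun u w h => hcen (by rw [hw, hw, h]), hcrd, ?_, fun w i => ?_, fun w i => ?_⟩, hw⟩
  · exact alcoveCenter_injOn (hcrd 1).1 (by norm_num) (by rw [← hw, cen_one])
  · exact alcoveCenter_injOn (hcrd _).1 ((hcrd w).adjacentAlcove _).1 (by rw [← hw, hws])
  · exact alcoveCenter_injOn (hcrd _).1 ((hcrd w).reflectAlcove i).1
      (by rw [← hw, cen_mul, hw, act_center _ _ (hcrd w).1])

end Alcoves

section LowerIntervals

theorem residueSwap_cases (r e : ℤ) :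
    ((e - r) % 3 = 0 ∧ residueSwap r e = e + 1) ∨ ((e - r) % 3 = 1 ∧ residueSwap r e = e - 1) ∨
      ((e - r) % 3 = 2 ∧ residueSwap r e = e) := by
  unfold residueSwap
  split_ifs <;> omega

theorem adjacentAlcove_adjacentAlcove (r : ℤ) (p : ℤ × ℤ × ℤ) :
    adjacentAlcove r (adjacentAlcove r p) = p := by
  have h (e : ℤ) : residueSwap r (residueSwap r e) = e := by
    have := residueSwap_cases r e
    have := residueSwap_cases r (residueSwap r e)
    omega
  simp [adjacentAlcove, h]

theorem adjacentAlcove_congr {r r' : ℤ} (h : (r - r') % 3 = 0) :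
    adjacentAlcove r = adjacentAlcove r' := by
  have h' (e : ℤ) : residueSwap r e = residueSwap r' e := by
    have := residueSwap_cases r e
    have := residueSwap_cases r' e
    omega
  funext p
  simp [adjacentAlcove, h']

theorem reflectAlcove_reflectAlcove (i : Fin 3) (p : ℤ × ℤ × ℤ) :
    reflectAlcove i (reflectAlcove i p) = p := by
  fin_cases i <;> simp [reflectAlcove]

variable {W : Type*} [Group W] {M : CoxeterMatrix (Fin 3)} {cs : CoxeterSystem M W}
  {crd : W → ℤ × ℤ × ℤ}

namespace IsAlcoveLabelling

theorem crd_mem_image_iff (L : IsAlcoveLabelling cs crd) {y z : W} :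
    crd z ∈ crd '' {z | bruhatLE cs z y} ↔ bruhatLE cs z y :=
  L.injective.mem_set_image

theorem image_lower_one (L : IsAlcoveLabelling cs crd) :
    crd '' {z | bruhatLE cs z 1} = {(-1, 0, 1)} := by
  simp [bruhatLE_one_iff, L.one]

theorem image_lower_mul_simple (L : IsAlcoveLabelling cs crd) {y : W} {i : Fin 3} {r : ℤ}
    (hr : (r - ((i : ℕ) + 1)) % 3 = 0) {T T' : Set (ℤ × ℤ × ℤ)}
    (hT : crd '' {z | bruhatLE cs z y} = T) (hy : adjacentAlcove r (crd y) ∉ T)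
    (hT' : ∀ p, p ∈ T' ↔ p ∈ T ∨ adjacentAlcove r p ∈ T) :
    crd '' {z | bruhatLE cs z (y * cs.simple i)} = T' := by
  have crd_mul (w : W) : crd (w * cs.simple i) = adjacentAlcove r (crd w) := by
    rw [L.mul_simple, adjacentAlcove_congr hr]
  subst hT
  rw [← crd_mul, L.crd_mem_image_iff] at hy
  ext p
  rw [hT']
  constructor
  · rintro ⟨z, hz, rfl⟩
    rw [← crd_mul, L.crd_mem_image_iff, L.crd_mem_image_iff]
    exact (bruhatLE_mul_simple_iff cs hy z).1 hz
  · rintro (⟨z, hz, rfl⟩ | ⟨z, hz, h⟩)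
    · exact ⟨z, (bruhatLE_mul_simple_iff cs hy z).2 (.inl hz), rfl⟩
    · refine ⟨z * cs.simple i, (bruhatLE_mul_simple_iff cs hy _).2 (.inr ?_), ?_⟩
      · rwa [cs.simple_mul_simple_cancel_right]
      · rw [crd_mul, h, adjacentAlcove_adjacentAlcove]

theorem image_lower_simple_mul (L : IsAlcoveLabelling cs crd) {y : W} (i : Fin 3)
    {T T' : Set (ℤ × ℤ × ℤ)}
    (hT : crd '' {z | bruhatLE cs z y} = T) (hy : reflectAlcove i (crd y) ∉ T)
    (hT' : ∀ p, p ∈ T' ↔ p ∈ T ∨ reflectAlcove i p ∈ T) :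
    crd '' {z | bruhatLE cs z (cs.simple i * y)} = T' := by
  subst hT
  rw [← L.simple_mul, L.crd_mem_image_iff] at hy
  ext p
  rw [hT']
  constructor
  · rintro ⟨z, hz, rfl⟩
    rw [← L.simple_mul, L.crd_mem_image_iff, L.crd_mem_image_iff]
    exact (bruhatLE_simple_mul_iff cs hy z).1 hz
  · rintro (⟨z, hz, rfl⟩ | ⟨z, hz, h⟩)
    · exact ⟨z, (bruhatLE_simple_mul_iff cs hy z).2 (.inl hz), rfl⟩
    · refine ⟨cs.simple i * z, (bruhatLE_simple_mul_iff cs hy _).2 (.inr ?_), ?_⟩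
      · rwa [cs.simple_mul_simple_cancel_left]
      · rw [L.simple_mul, h, reflectAlcove_reflectAlcove]

/-- Determination of the alcoves below `w` from those below the adjacent alcove of type `r`. -/
theorem image_lower_of_adjacent (L : IsAlcoveLabelling cs crd) {w : W} (r : ℤ)
    {T T' : Set (ℤ × ℤ × ℤ)}
    (hT : ∀ y, crd y = adjacentAlcove r (crd w) → crd '' {z | bruhatLE cs z y} = T)
    (hw : crd w ∉ T) (hT' : ∀ p, p ∈ T' ↔ p ∈ T ∨ adjacentAlcove r p ∈ T) :
    crd '' {z | bruhatLE cs z w} = T' := by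
  obtain ⟨i, hi⟩ : ∃ i : Fin 3, (r - ((i : ℕ) + 1)) % 3 = 0 := by
    have : r % 3 = 0 ∨ r % 3 = 1 ∨ r % 3 = 2 := by omega
    rcases this with h | h | h
    exacts [⟨2, by simp; omega⟩, ⟨0, by simp; omega⟩, ⟨1, by simp; omega⟩]
  have hadj : crd (w * cs.simple i) = adjacentAlcove r (crd w) := by
    rw [L.mul_simple, adjacentAlcove_congr hi]
  have := L.image_lower_mul_simple hi (hT _ hadj)
    (by rwa [hadj, adjacentAlcove_adjacentAlcove]) hT'
  rwa [cs.simple_mul_simple_cancel_right] at this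

end IsAlcoveLabelling

/-- The alcoves whose coordinates lie between the given bounds. -/
def alcoveBox (l u : ℤ × ℤ × ℤ) : Set (ℤ × ℤ × ℤ) := {p | IsAlcove p ∧ l ≤ p ∧ p ≤ u}

theorem mem_alcoveBox {l₁ l₂ l₃ u₁ u₂ u₃ x y z : ℤ} :
    (x, y, z) ∈ alcoveBox (l₁, l₂, l₃) (u₁, u₂, u₃) ↔
      (x + y + z = 0 ∧ x % 3 ≠ y % 3 ∧ y % 3 ≠ z % 3 ∧ x % 3 ≠ z % 3) ∧
        (l₁ ≤ x ∧ l₂ ≤ y ∧ l₃ ≤ z) ∧ x ≤ u₁ ∧ y ≤ u₂ ∧ z ≤ u₃ := Iff.rfl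

theorem mem_alcoveBox_adjacentAlcove {l₁ l₂ l₃ u₁ u₂ u₃ x y z r : ℤ} :
    adjacentAlcove r (x, y, z) ∈ alcoveBox (l₁, l₂, l₃) (u₁, u₂, u₃) ↔
      (x + y + z = 0 ∧ x % 3 ≠ y % 3 ∧ y % 3 ≠ z % 3 ∧ x % 3 ≠ z % 3) ∧
        (l₁ ≤ residueSwap r x ∧ l₂ ≤ residueSwap r y ∧ l₃ ≤ residueSwap r z) ∧
          residueSwap r x ≤ u₁ ∧ residueSwap r y ≤ u₂ ∧ residueSwap r z ≤ u₃ := by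
  have h : IsAlcove (adjacentAlcove r (x, y, z)) ↔ IsAlcove (x, y, z) :=
    ⟨fun h => by simpa [adjacentAlcove_adjacentAlcove] using h.adjacentAlcove r,
      fun h => h.adjacentAlcove r⟩
  exact and_congr h Iff.rfl

theorem finite_alcoveBox (l u : ℤ × ℤ × ℤ) : (alcoveBox l u).Finite :=
  (Set.finite_Icc l u).subset fun _ hp => hp.2

set_option maxHeartbeats 2000000 in
theorem alcoveBox_adjacent_theta {A B : ℤ} (hAB : (A + B) % 3 = 2) (h1 : A < 2 * B)
    (h2 : B < 2 * A) (p : ℤ × ℤ × ℤ) :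
    p ∈ alcoveBox (-B - 1, -B - 1, -B - 1) (A + 1, A + 1, A + 1) ↔
      p ∈ alcoveBox (-B, -B, -B) (A, A, A) ∨
        adjacentAlcove A p ∈ alcoveBox (-B, -B, -B) (A, A, A) := by
  obtain ⟨x, y, z⟩ := p
  rw [mem_alcoveBox, mem_alcoveBox, mem_alcoveBox_adjacentAlcove, ← and_or_left]
  refine and_congr_right fun hp => ?_
  rcases residueSwap_cases A x with ⟨hx, ex⟩ | ⟨hx, ex⟩ | ⟨hx, ex⟩ <;>
  rcases residueSwap_cases A y with ⟨hy, ey⟩ | ⟨hy, ey⟩ | ⟨hy, ey⟩ <;>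
  rcases residueSwap_cases A z with ⟨hz, ez⟩ | ⟨hz, ez⟩ | ⟨hz, ez⟩ <;>
  first
  | (exfalso; omega)
  | (rw [ex, ey, ez]; omega)

theorem alcoveBox_adjacent_upper {A B : ℤ} (hAB : (A + B) % 3 = 1)
    (h : B ≤ 2 * A) (p : ℤ × ℤ × ℤ) :
    p ∈ alcoveBox (-B, -B, -B) (A + 1, A + 1, A + 1) ↔
      p ∈ alcoveBox (-B, -B, -B) (A, A, A) ∨
        adjacentAlcove A p ∈ alcoveBox (-B, -B, -B) (A, A, A) := by
  obtain ⟨x, y, z⟩ := p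
  rw [mem_alcoveBox, mem_alcoveBox, mem_alcoveBox_adjacentAlcove, ← and_or_left]
  refine and_congr_right fun hp => ?_
  rcases residueSwap_cases A x with ⟨hx, ex⟩ | ⟨hx, ex⟩ | ⟨hx, ex⟩ <;>
  rcases residueSwap_cases A y with ⟨hy, ey⟩ | ⟨hy, ey⟩ | ⟨hy, ey⟩ <;>
  rcases residueSwap_cases A z with ⟨hz, ez⟩ | ⟨hz, ez⟩ | ⟨hz, ez⟩ <;>
  first
  | (exfalso; omega)
  | (rw [ex, ey, ez]; omega)

theorem alcoveBox_adjacent_lower {A B : ℤ} (hAB : (A + B) % 3 = 1)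
    (h : A ≤ 2 * B) (p : ℤ × ℤ × ℤ) :
    p ∈ alcoveBox (-B - 1, -B - 1, -B - 1) (A, A, A) ↔
      p ∈ alcoveBox (-B, -B, -B) (A, A, A) ∨
        adjacentAlcove (-B - 1) p ∈ alcoveBox (-B, -B, -B) (A, A, A) := by
  obtain ⟨x, y, z⟩ := p
  rw [mem_alcoveBox, mem_alcoveBox, mem_alcoveBox_adjacentAlcove, ← and_or_left]
  refine and_congr_right fun hp => ?_
  rcases residueSwap_cases (-B - 1) x with ⟨hx, ex⟩ | ⟨hx, ex⟩ | ⟨hx, ex⟩ <;>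
  rcases residueSwap_cases (-B - 1) y with ⟨hy, ey⟩ | ⟨hy, ey⟩ | ⟨hy, ey⟩ <;>
  rcases residueSwap_cases (-B - 1) z with ⟨hz, ez⟩ | ⟨hz, ez⟩ | ⟨hz, ez⟩ <;>
  first
  | (exfalso; omega)
  | (rw [ex, ey, ez]; omega)

theorem alcoveBox_adjacent_even (j : ℤ) (hj : 1 ≤ j) (p : ℤ × ℤ × ℤ) :
    p ∈ alcoveBox (-j - 1, -j - 1, 1 - j) (2 * j, 2 * j, 2 * j) ↔
      p ∈ alcoveBox (-j, -j, 1 - j) (2 * j - 1, 2 * j - 1, 2 * j - 1) ∨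
        adjacentAlcove (2 * j - 1) p ∈
          alcoveBox (-j, -j, 1 - j) (2 * j - 1, 2 * j - 1, 2 * j - 1) := by
  obtain ⟨x, y, z⟩ := p
  rw [mem_alcoveBox, mem_alcoveBox, mem_alcoveBox_adjacentAlcove, ← and_or_left]
  refine and_congr_right fun hp => ?_
  rcases residueSwap_cases (2 * j - 1) x with ⟨hx, ex⟩ | ⟨hx, ex⟩ | ⟨hx, ex⟩ <;>
  rcases residueSwap_cases (2 * j - 1) y with ⟨hy, ey⟩ | ⟨hy, ey⟩ | ⟨hy, ey⟩ <;>
  rcases residueSwap_cases (2 * j - 1) z with ⟨hz, ez⟩ | ⟨hz, ez⟩ | ⟨hz, ez⟩ <;>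
  first
  | (exfalso; omega)
  | (rw [ex, ey, ez]; omega)

theorem alcoveBox_adjacent_odd (j : ℤ) (hj : 1 ≤ j) (p : ℤ × ℤ × ℤ) :
    p ∈ alcoveBox (-j - 1, -j - 1, -j) (2 * j + 1, 2 * j + 1, 2 * j + 1) ↔
      p ∈ alcoveBox (-j - 1, -j - 1, 1 - j) (2 * j, 2 * j, 2 * j) ∨
        adjacentAlcove (2 * j) p ∈ alcoveBox (-j - 1, -j - 1, 1 - j) (2 * j, 2 * j, 2 * j) := by
  obtain ⟨x, y, z⟩ := p
  rw [mem_alcoveBox, mem_alcoveBox, mem_alcoveBox_adjacentAlcove, ← and_or_left]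
  refine and_congr_right fun hp => ?_
  rcases residueSwap_cases (2 * j) x with ⟨hx, ex⟩ | ⟨hx, ex⟩ | ⟨hx, ex⟩ <;>
  rcases residueSwap_cases (2 * j) y with ⟨hy, ey⟩ | ⟨hy, ey⟩ | ⟨hy, ey⟩ <;>
  rcases residueSwap_cases (2 * j) z with ⟨hz, ez⟩ | ⟨hz, ez⟩ | ⟨hz, ez⟩ <;>
  first
  | (exfalso; omega)
  | (rw [ex, ey, ez]; omega)

theorem alcoveBox_reflect {A B : ℤ} (h1 : A + 2 ≤ 2 * B) (h2 : B + 2 ≤ 2 * A)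
    (p : ℤ × ℤ × ℤ) :
    p ∈ alcoveBox (-B - 3, -B, -B) (A, A, A + 3) ↔
      p ∈ alcoveBox (-B, -B, -B) (A, A, A) ∨
        reflectAlcove 0 p ∈ alcoveBox (-B, -B, -B) (A, A, A) := by
  obtain ⟨x, y, z⟩ := p
  simp only [reflectAlcove, mem_alcoveBox]
  omega

end LowerIntervals

section Counting

theorem ncard_residue_ne {c lo hi : ℤ} {N : ℕ}
    (hN : (N : ℤ) = hi + 1 - lo - (hi + 1 - lo + 2 - (c - lo) % 3) / 3) :
    {y : ℤ | lo ≤ y ∧ y ≤ hi ∧ y % 3 ≠ c % 3}.ncard = N := by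
  have key : {y : ℤ | lo ≤ y ∧ y ≤ hi ∧ y % 3 ≠ c % 3} =
      (fun i : ℕ => lo + i + (i + 2 - (c - lo) % 3) / 2) '' (Finset.range N : Set ℕ) := by
    ext y
    simp only [Set.mem_ofPred_eq, Set.mem_image, Finset.coe_range, Set.mem_Iio]
    constructor
    · rintro ⟨h1, h2, h3⟩
      exact ⟨(y - lo - (y - lo + 2 - (c - lo) % 3) / 3).toNat, by omega, by omega⟩
    · rintro ⟨i, hi, rfl⟩
      omega
  rw [key, Set.ncard_image_of_injective, Set.ncard_coe_finset, Finset.card_range]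
  intro i j hij
  dsimp only at hij
  omega

theorem ncard_eq_add_of_slice {S S' : Set (ℤ × ℤ × ℤ)} (hS : S.Finite) {f : ℤ → ℤ × ℤ × ℤ}
    (hf : Function.Injective f) {c lo hi : ℤ} {N : ℕ}
    (hN : (N : ℤ) = hi + 1 - lo - (hi + 1 - lo + 2 - (c - lo) % 3) / 3)
    (hdisj : ∀ y, f y ∉ S)
    (hS' : ∀ p, p ∈ S' ↔ p ∈ S ∨ ∃ y, (lo ≤ y ∧ y ≤ hi ∧ y % 3 ≠ c % 3) ∧ f y = p) :
    S'.ncard = S.ncard + N := by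
  have hN' := ncard_residue_ne hN
  have hfin : {y : ℤ | lo ≤ y ∧ y ≤ hi ∧ y % 3 ≠ c % 3}.Finite :=
    (Set.finite_Icc lo hi).subset fun y hy => ⟨hy.1, hy.2.1⟩
  have e : S' = S ∪ f '' {y : ℤ | lo ≤ y ∧ y ≤ hi ∧ y % 3 ≠ c % 3} := Set.ext hS'
  rw [e, Set.ncard_union_eq ?_ hS (hfin.image f), Set.ncard_image_of_injective _ hf, hN']
  rw [Set.disjoint_right]
  rintro _ ⟨y, -, rfl⟩
  exact hdisj y

variable {l₁ l₂ l₃ u₁ u₂ u₃ l' u' : ℤ}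

theorem ncard_alcoveBox_extend_fst (c lo hi : ℤ) (N : ℕ)
    (hN : (N : ℤ) = hi + 1 - lo - (hi + 1 - lo + 2 - (c - lo) % 3) / 3)
    (hc : ¬ (l₁ ≤ c ∧ c ≤ u₁))
    (hc' : ∀ x, l' ≤ x ∧ x ≤ u' ↔ (l₁ ≤ x ∧ x ≤ u₁) ∨ x = c)
    (hrange : ∀ y, (lo ≤ y ∧ y ≤ hi) ↔
      (l₂ ≤ y ∧ l₃ ≤ -c - y) ∧ y ≤ u₂ ∧ -c - y ≤ u₃) :
    (alcoveBox (l', l₂, l₃) (u', u₂, u₃)).ncard =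
      (alcoveBox (l₁, l₂, l₃) (u₁, u₂, u₃)).ncard + N := by
  refine ncard_eq_add_of_slice (finite_alcoveBox _ _) (f := fun y => (c, y, -c - y))
    (fun y y' h => by simpa using h) hN (fun y hy => ?_) fun p => ?_
  · rw [mem_alcoveBox] at hy
    omega
  · obtain ⟨x, y, z⟩ := p
    simp only [mem_alcoveBox, Prod.mk.injEq]
    have hx := hc' x
    have hy := hrange y
    constructor
    · intro hp
      by_cases hxc : x = c
      · exact .inr ⟨y, by omega, by omega⟩
      · left
        omega
    · rintro (hp | ⟨y', hy', rfl, rfl, rfl⟩)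
      · omega
      · omega

theorem ncard_alcoveBox_extend_snd (c lo hi : ℤ) (N : ℕ)
    (hN : (N : ℤ) = hi + 1 - lo - (hi + 1 - lo + 2 - (c - lo) % 3) / 3)
    (hc : ¬ (l₂ ≤ c ∧ c ≤ u₂))
    (hc' : ∀ y, l' ≤ y ∧ y ≤ u' ↔ (l₂ ≤ y ∧ y ≤ u₂) ∨ y = c)
    (hrange : ∀ z, (lo ≤ z ∧ z ≤ hi) ↔
      (l₃ ≤ z ∧ l₁ ≤ -c - z) ∧ z ≤ u₃ ∧ -c - z ≤ u₁) :
    (alcoveBox (l₁, l', l₃) (u₁, u', u₃)).ncard =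
      (alcoveBox (l₁, l₂, l₃) (u₁, u₂, u₃)).ncard + N := by
  refine ncard_eq_add_of_slice (finite_alcoveBox _ _) (f := fun z => (-c - z, c, z))
    (fun y y' h => by simpa using h) hN (fun y hy => ?_) fun p => ?_
  · rw [mem_alcoveBox] at hy
    omega
  · obtain ⟨x, y, z⟩ := p
    simp only [mem_alcoveBox, Prod.mk.injEq]
    have hy := hc' y
    have hz := hrange z
    constructor
    · intro hp
      by_cases hyc : y = c
      · exact .inr ⟨z, by omega, by omega⟩
      · left
        omega
    · rintro (hp | ⟨z', hz', rfl, rfl, rfl⟩)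
      · omega
      · omega

theorem ncard_alcoveBox_extend_thd (c lo hi : ℤ) (N : ℕ)
    (hN : (N : ℤ) = hi + 1 - lo - (hi + 1 - lo + 2 - (c - lo) % 3) / 3)
    (hc : ¬ (l₃ ≤ c ∧ c ≤ u₃))
    (hc' : ∀ z, l' ≤ z ∧ z ≤ u' ↔ (l₃ ≤ z ∧ z ≤ u₃) ∨ z = c)
    (hrange : ∀ x, (lo ≤ x ∧ x ≤ hi) ↔
      (l₁ ≤ x ∧ l₂ ≤ -c - x) ∧ x ≤ u₁ ∧ -c - x ≤ u₂) :
    (alcoveBox (l₁, l₂, l') (u₁, u₂, u')).ncard =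
      (alcoveBox (l₁, l₂, l₃) (u₁, u₂, u₃)).ncard + N := by
  refine ncard_eq_add_of_slice (finite_alcoveBox _ _) (f := fun x => (x, -c - x, c))
    (fun y y' h => by simpa using h) hN (fun y hy => ?_) fun p => ?_
  · rw [mem_alcoveBox] at hy
    omega
  · obtain ⟨x, y, z⟩ := p
    simp only [mem_alcoveBox, Prod.mk.injEq]
    have hz := hc' z
    have hx := hrange x
    constructor
    · intro hp
      by_cases hzc : z = c
      · exact .inr ⟨x, by omega, by omega⟩
      · left
        omega
    · rintro (hp | ⟨x', hx', rfl, rfl, rfl⟩)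
      · omega
      · omega

theorem ncard_alcoveBox_thetaS {A B : ℤ} (m n : ℕ) (hA : A = 2 * m + n + 1)
    (hB : B = m + 2 * n + 1) :
    (alcoveBox (-B - 1, -B - 1, -B - 1) (A + 1, A + 1, A + 1)).ncard =
      (alcoveBox (-B, -B, -B) (A, A, A)).ncard + 6 * (m + n + 1) := by
  rw [ncard_alcoveBox_extend_thd (l₃ := -B) (u₃ := A + 1) (-B - 1) (B - A) (A + 1) (2 * m + 2)
      (by omega) (by omega) (by omega) (by omega),
    ncard_alcoveBox_extend_snd (l₂ := -B) (u₂ := A + 1) (-B - 1) (B - A) (A + 1) (2 * m + 2)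
      (by omega) (by omega) (by omega) (by omega),
    ncard_alcoveBox_extend_fst (l₁ := -B) (u₁ := A + 1) (-B - 1) (B - A) (A + 1) (2 * m + 2)
      (by omega) (by omega) (by omega) (by omega),
    ncard_alcoveBox_extend_thd (l₃ := -B) (u₃ := A) (A + 1) (-B) (B - A - 1) (2 * n)
      (by omega) (by omega) (by omega) (by omega),
    ncard_alcoveBox_extend_snd (l₂ := -B) (u₂ := A) (A + 1) (-B) (B - A - 1) (2 * n)
      (by omega) (by omega) (by omega) (by omega),
    ncard_alcoveBox_extend_fst (l₁ := -B) (u₁ := A) (A + 1) (-B) (B - A - 1) (2 * n)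
      (by omega) (by omega) (by omega) (by omega)]
  ring

theorem ncard_alcoveBox_upper {A B : ℤ} (m n : ℕ) (hA : A = 2 * m + n + 2)
    (hB : B = m + 2 * n + 2) :
    (alcoveBox (-B, -B, -B) (A + 1, A + 1, A + 1)).ncard =
      (alcoveBox (-B, -B, -B) (A, A, A)).ncard + 6 * (n + 1) := by
  rw [ncard_alcoveBox_extend_thd (l₃ := -B) (u₃ := A) (A + 1) (-B) (B - A - 1) (2 * n + 2)
      (by omega) (by omega) (by omega) (by omega),
    ncard_alcoveBox_extend_snd (l₂ := -B) (u₂ := A) (A + 1) (-B) (B - A - 1) (2 * n + 2)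
      (by omega) (by omega) (by omega) (by omega),
    ncard_alcoveBox_extend_fst (l₁ := -B) (u₁ := A) (A + 1) (-B) (B - A - 1) (2 * n + 2)
      (by omega) (by omega) (by omega) (by omega)]
  ring

theorem ncard_alcoveBox_lower {A B : ℤ} (m n : ℕ) (hA : A = 2 * m + n + 2)
    (hB : B = m + 2 * n + 2) :
    (alcoveBox (-B - 1, -B - 1, -B - 1) (A, A, A)).ncard =
      (alcoveBox (-B, -B, -B) (A, A, A)).ncard + 6 * (m + 1) := by
  rw [ncard_alcoveBox_extend_thd (l₃ := -B) (u₃ := A) (-B - 1) (B + 1 - A) A (2 * m + 2)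
      (by omega) (by omega) (by omega) (by omega),
    ncard_alcoveBox_extend_snd (l₂ := -B) (u₂ := A) (-B - 1) (B + 1 - A) A (2 * m + 2)
      (by omega) (by omega) (by omega) (by omega),
    ncard_alcoveBox_extend_fst (l₁ := -B) (u₁ := A) (-B - 1) (B + 1 - A) A (2 * m + 2)
      (by omega) (by omega) (by omega) (by omega)]
  ring

theorem ncard_alcoveBox_reflect {A B : ℤ} (m n : ℕ) (hA : A = 2 * m + n + 2)
    (hB : B = m + 2 * n + 2) :
    (alcoveBox (-B - 3, -B, -B) (A, A, A + 3)).ncard =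
      (alcoveBox (-B, -B, -B) (A, A, A)).ncard + (6 * m + 6 * n + 10) := by
  rw [ncard_alcoveBox_extend_fst (l₁ := -B - 2) (u₁ := A) (-B - 3) (B - A) A (2 * m + 2)
      (by omega) (by omega) (by omega) (by omega),
    ncard_alcoveBox_extend_fst (l₁ := -B - 1) (u₁ := A) (-B - 2) (B - A - 1) A (2 * m + 2)
      (by omega) (by omega) (by omega) (by omega),
    ncard_alcoveBox_extend_fst (l₁ := -B) (u₁ := A) (-B - 1) (B - A - 2) A (2 * m + 4)
      (by omega) (by omega) (by omega) (by omega),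
    ncard_alcoveBox_extend_thd (l₃ := -B) (u₃ := A + 2) (A + 3) (-B) (B - A - 3) (2 * n)
      (by omega) (by omega) (by omega) (by omega),
    ncard_alcoveBox_extend_thd (l₃ := -B) (u₃ := A + 1) (A + 2) (-B) (B - A - 2) (2 * n)
      (by omega) (by omega) (by omega) (by omega),
    ncard_alcoveBox_extend_thd (l₃ := -B) (u₃ := A) (A + 1) (-B) (B - A - 1) (2 * n + 2)
      (by omega) (by omega) (by omega) (by omega)]
  ring

theorem ncard_alcoveBox_even (j : ℕ) (hj : 1 ≤ j) :
    (alcoveBox (-j - 1, -j - 1, 1 - j) (2 * j, 2 * j, 2 * j)).ncard =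
      (alcoveBox (-j, -j, 1 - j) (2 * j - 1, 2 * j - 1, 2 * j - 1)).ncard + 4 * j := by
  rw [ncard_alcoveBox_extend_snd (l₂ := -j) (u₂ := 2 * j) (-j - 1) (1 - j) (2 * j) (2 * j)
      (by omega) (by omega) (by omega) (by omega),
    ncard_alcoveBox_extend_fst (l₁ := -j) (u₁ := 2 * j) (-j - 1) (1 - j) (2 * j) (2 * j)
      (by omega) (by omega) (by omega) (by omega),
    ncard_alcoveBox_extend_thd (l₃ := 1 - j) (u₃ := 2 * j - 1) (2 * j) (-j) (-j) 0
      (by omega) (by omega) (by omega) (by omega),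
    ncard_alcoveBox_extend_snd (l₂ := -j) (u₂ := 2 * j - 1) (2 * j) (1 - j) (-j) 0
      (by omega) (by omega) (by omega) (by omega),
    ncard_alcoveBox_extend_fst (l₁ := -j) (u₁ := 2 * j - 1) (2 * j) (-j) (-j - 1) 0
      (by omega) (by omega) (by omega) (by omega)]
  ring

theorem ncard_alcoveBox_odd (j : ℕ) :
    (alcoveBox (-j - 1, -j - 1, -j) (2 * j + 1, 2 * j + 1, 2 * j + 1)).ncard =
      (alcoveBox (-j - 1, -j - 1, 1 - j) (2 * j, 2 * j, 2 * j)).ncard + (2 * j + 4) := by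
  rw [ncard_alcoveBox_extend_thd (l₃ := 1 - j) (u₃ := 2 * j + 1) (-j) (-j - 1) (2 * j + 1)
      (2 * j + 2) (by omega) (by omega) (by omega) (by omega),
    ncard_alcoveBox_extend_thd (l₃ := 1 - j) (u₃ := 2 * j) (2 * j + 1) (-j - 1) (-j) 2
      (by omega) (by omega) (by omega) (by omega),
    ncard_alcoveBox_extend_snd (l₂ := -j - 1) (u₂ := 2 * j) (2 * j + 1) (1 - j) (-j) 0
      (by omega) (by omega) (by omega) (by omega),
    ncard_alcoveBox_extend_fst (l₁ := -j - 1) (u₁ := 2 * j) (2 * j + 1) (-j - 1) (-j - 2) 0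
      (by omega) (by omega) (by omega) (by omega)]
  ring

theorem ncard_alcoveBox_two_mul_add_one (k : ℕ) :
    (alcoveBox (-k - 1, -k - 1, 1 - k) (2 * k, 2 * k, 2 * k)).ncard = 3 * k ^ 2 + 5 * k := by
  induction k with
  | zero =>
    rw [show 3 * 0 ^ 2 + 5 * 0 = 0 from rfl, Set.ncard_eq_zero (finite_alcoveBox _ _),
      Set.eq_empty_iff_forall_notMem]
    rintro ⟨x, y, z⟩ h
    rw [mem_alcoveBox] at h
    omega
  | succ k ih =>
    have h := ncard_alcoveBox_odd k
    have h' := ncard_alcoveBox_even (k + 1) (by omega)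
    push_cast at h' ⊢
    ring_nf at h h' ih ⊢
    rw [h', h, ih]
    ring

theorem ncard_alcoveBox_two_mul {k : ℕ} (hk : 1 ≤ k) :
    (alcoveBox (-k, -k, 1 - k) (2 * k - 1, 2 * k - 1, 2 * k - 1)).ncard = 3 * k ^ 2 + k := by
  have h := ncard_alcoveBox_two_mul_add_one k
  rw [ncard_alcoveBox_even k hk] at h
  omega

theorem ncard_alcoveBox_theta (m n : ℕ) {A B : ℤ} (hA : A = 2 * m + n + 1)
    (hB : B = m + 2 * n + 1) :
    (alcoveBox (-B, -B, -B) (A, A, A)).ncard =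
      3 * m ^ 2 + 3 * n ^ 2 + 12 * m * n + 9 * m + 9 * n + 6 := by
  induction n generalizing A B with
  | zero =>
    induction m generalizing A B with
    | zero =>
      have h := ncard_alcoveBox_two_mul le_rfl
      norm_num at hA hB h
      subst hA hB
      rw [ncard_alcoveBox_extend_thd (l₃ := 0) (u₃ := 1) (-1) 0 1 2
        (by omega) (by omega) (by omega) (by omega), h]
      rfl
    | succ m ih =>
      have h := ncard_alcoveBox_upper m 0 (A := A - 1) (B := B) (by push_cast at *; omega)
        (by push_cast at *; omega)
      have h' := ncard_alcoveBox_thetaS m 0 (A := A - 2) (B := B - 1) (by push_cast at *; omega)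
        (by push_cast at *; omega)
      rw [ih (by push_cast at *; omega) (by push_cast at *; omega)] at h'
      ring_nf at h h' ⊢
      rw [h, h']
      ring
  | succ n ih =>
    have h := ncard_alcoveBox_lower m n (A := A) (B := B - 1) (by push_cast at *; omega)
      (by push_cast at *; omega)
    have h' := ncard_alcoveBox_thetaS m n (A := A - 1) (B := B - 2) (by push_cast at *; omega)
      (by push_cast at *; omega)
    rw [ih (by push_cast at *; omega) (by push_cast at *; omega)] at h'
    ring_nf at h h' ⊢
    rw [h, h']
    ring

end Counting

section LowerSets

theorem adjacentAlcove_eq {r x y z x' y' z' : ℤ}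
    (hx : ((x - r) % 3 = 0 ∧ x' = x + 1) ∨ ((x - r) % 3 = 1 ∧ x' = x - 1) ∨
      ((x - r) % 3 = 2 ∧ x' = x))
    (hy : ((y - r) % 3 = 0 ∧ y' = y + 1) ∨ ((y - r) % 3 = 1 ∧ y' = y - 1) ∨
      ((y - r) % 3 = 2 ∧ y' = y))
    (hz : ((z - r) % 3 = 0 ∧ z' = z + 1) ∨ ((z - r) % 3 = 1 ∧ z' = z - 1) ∨
      ((z - r) % 3 = 2 ∧ z' = z)) :
    adjacentAlcove r (x, y, z) = (x', y', z') := by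
  have := residueSwap_cases r x
  have := residueSwap_cases r y
  have := residueSwap_cases r z
  simp only [adjacentAlcove, Prod.mk.injEq]
  omega

theorem alcoveBox_adjacent_one (p : ℤ × ℤ × ℤ) :
    p ∈ alcoveBox (-1, -1, 1) (0, 0, 1) ↔
      p ∈ ({(-1, 0, 1)} : Set (ℤ × ℤ × ℤ)) ∨
        adjacentAlcove (-1) p ∈ ({(-1, 0, 1)} : Set (ℤ × ℤ × ℤ)) := by
  obtain ⟨x, y, z⟩ := p
  have := residueSwap_cases (-1) x
  have := residueSwap_cases (-1) y
  have := residueSwap_cases (-1) z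
  simp only [mem_alcoveBox, adjacentAlcove, Set.mem_singleton_iff, Prod.mk.injEq]
  omega

theorem alcoveBox_adjacent_two (p : ℤ × ℤ × ℤ) :
    p ∈ alcoveBox (-1, -1, 0) (1, 1, 1) ↔
      p ∈ alcoveBox (-1, -1, 1) (0, 0, 1) ∨
        adjacentAlcove 0 p ∈ alcoveBox (-1, -1, 1) (0, 0, 1) := by
  obtain ⟨x, y, z⟩ := p
  have := residueSwap_cases 0 x
  have := residueSwap_cases 0 y
  have := residueSwap_cases 0 z
  rw [mem_alcoveBox, mem_alcoveBox, mem_alcoveBox_adjacentAlcove]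
  omega

theorem alcoveBox_adjacent_three (p : ℤ × ℤ × ℤ) :
    p ∈ alcoveBox (-1, -1, -1) (1, 1, 1) ↔
      p ∈ alcoveBox (-1, -1, 0) (1, 1, 1) ∨
        adjacentAlcove (-1) p ∈ alcoveBox (-1, -1, 0) (1, 1, 1) := by
  obtain ⟨x, y, z⟩ := p
  have := residueSwap_cases (-1) x
  have := residueSwap_cases (-1) y
  have := residueSwap_cases (-1) z
  rw [mem_alcoveBox, mem_alcoveBox, mem_alcoveBox_adjacentAlcove]
  omega

variable {W : Type*} [Group W] {M : CoxeterMatrix (Fin 3)} {cs : CoxeterSystem M W}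
  {crd : W → ℤ × ℤ × ℤ}

namespace IsAlcoveLabelling

theorem image_lower_two (L : IsAlcoveLabelling cs crd) {w : W} (hw : crd w = (1, -1, 0)) :
    crd '' {z | bruhatLE cs z w} = alcoveBox (-1, -1, 0) (1, 1, 1) := by
  refine L.image_lower_of_adjacent 0 (fun y hy => ?_)
    (by rw [hw, mem_alcoveBox]; omega) alcoveBox_adjacent_two
  rw [hw, adjacentAlcove_eq (x' := 0) (y' := -1) (z' := 1) (by omega) (by omega) (by omega)] at hy
  refine L.image_lower_of_adjacent (-1) (fun v hv => ?_)
    (by rw [hy]; simp) alcoveBox_adjacent_one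
  rw [hy, adjacentAlcove_eq (x' := -1) (y' := 0) (z' := 1) (by omega) (by omega) (by omega),
    ← L.one] at hv
  rw [L.injective hv, L.image_lower_one]

theorem image_lower_odd (L : IsAlcoveLabelling cs crd) {j : ℤ} (hj : 1 ≤ j)
    (ih : ∀ w, crd w = (2 * j - 1, -j, 1 - j) → crd '' {z | bruhatLE cs z w} =
      alcoveBox (-j, -j, 1 - j) (2 * j - 1, 2 * j - 1, 2 * j - 1))
    {w : W} (hw : crd w = (2 * j, -j - 1, 1 - j)) :
    crd '' {z | bruhatLE cs z w} =
      alcoveBox (-j - 1, -j - 1, 1 - j) (2 * j, 2 * j, 2 * j) := by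
  refine L.image_lower_of_adjacent (2 * j - 1) (fun y hy => ih y ?_)
    (by rw [hw, mem_alcoveBox]; omega) (alcoveBox_adjacent_even j hj)
  rw [hy, hw]
  exact adjacentAlcove_eq (by omega) (by omega) (by omega)

theorem image_lower_even (L : IsAlcoveLabelling cs crd) {j : ℕ} (hj : 1 ≤ j)
    {w : W} (hw : crd w = (2 * (j : ℤ) - 1, -(j : ℤ), 1 - (j : ℤ))) :
    crd '' {z | bruhatLE cs z w} =
      alcoveBox (-j, -j, 1 - j) (2 * j - 1, 2 * j - 1, 2 * j - 1) := by
  induction j, hj using Nat.le_induction generalizing w with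
  | base => simpa using L.image_lower_two (w := w) (by simpa using hw)
  | succ j hj ih =>
    have hj' : (1 : ℤ) ≤ j := by exact_mod_cast hj
    have h := alcoveBox_adjacent_odd j hj'
    push_cast at hw ⊢
    rw [show -((j : ℤ) + 1) = -j - 1 by ring, show 1 - ((j : ℤ) + 1) = -j by ring,
      show 2 * ((j : ℤ) + 1) - 1 = 2 * j + 1 by ring] at *
    refine L.image_lower_of_adjacent (2 * j)
      (fun y hy => L.image_lower_odd hj' (fun v hv => ih hv) ?_)
      (by rw [hw, mem_alcoveBox]; omega) h
    rw [hy, hw]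
    exact adjacentAlcove_eq (by omega) (by omega) (by omega)

theorem image_lower_thetaS_of_theta (L : IsAlcoveLabelling cs crd) {A B : ℤ}
    (hAB : (A + B) % 3 = 2) (h1 : A < 2 * B) (h2 : B < 2 * A)
    (ih : ∀ w, crd w = (A, B - A, -B) →
      crd '' {z | bruhatLE cs z w} = alcoveBox (-B, -B, -B) (A, A, A))
    {w : W} (hw : crd w = (A + 1, B - A, -B - 1)) :
    crd '' {z | bruhatLE cs z w} =
      alcoveBox (-B - 1, -B - 1, -B - 1) (A + 1, A + 1, A + 1) := by
  refine L.image_lower_of_adjacent A (fun y hy => ih y ?_)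
    (by rw [hw, mem_alcoveBox]; omega) (alcoveBox_adjacent_theta hAB h1 h2)
  rw [hy, hw]
  exact adjacentAlcove_eq (by omega) (by omega) (by omega)

theorem image_lower_theta (L : IsAlcoveLabelling cs crd) (m n : ℕ) {A B : ℤ}
    (hA : A = 2 * m + n + 1) (hB : B = m + 2 * n + 1) {w : W} (hw : crd w = (A, B - A, -B)) :
    crd '' {z | bruhatLE cs z w} = alcoveBox (-B, -B, -B) (A, A, A) := by
  induction n generalizing A B w with
  | zero =>
    induction m generalizing A B w with
    | zero =>
      norm_num at hA hB
      subst hA hB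
      refine L.image_lower_of_adjacent (-1) (fun y hy => L.image_lower_two ?_)
        (by rw [hw, mem_alcoveBox]; omega) alcoveBox_adjacent_three
      rw [hy, hw]
      exact adjacentAlcove_eq (by omega) (by omega) (by omega)
    | succ m ih =>
      push_cast at hA hB
      have hS (v : W) := L.image_lower_thetaS_of_theta (A := A - 2) (B := B - 1) (by omega)
        (by omega) (by omega) (fun w => ih (by omega) (by omega)) (w := v)
      have h := alcoveBox_adjacent_upper (A := A - 1) (B := B) (by omega) (by omega)
      ring_nf at h hS ⊢
      refine L.image_lower_of_adjacent (-1 + A) (fun y hy => hS y ?_)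
        (by rw [hw, mem_alcoveBox]; omega) h
      rw [hy, hw]
      exact adjacentAlcove_eq (by omega) (by omega) (by omega)
  | succ n ih =>
    push_cast at hA hB
    have hS (v : W) := L.image_lower_thetaS_of_theta (A := A - 1) (B := B - 2) (by omega)
      (by omega) (by omega) (fun w => ih (by omega) (by omega)) (w := v)
    have h := alcoveBox_adjacent_lower (A := A) (B := B - 1) (by omega) (by omega)
    ring_nf at h hS ⊢
    refine L.image_lower_of_adjacent (-B) (fun y hy => hS y ?_)
      (by rw [hw, mem_alcoveBox]; omega) h
    rw [hy, hw]
    exact adjacentAlcove_eq (by omega) (by omega) (by omega)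

theorem image_lower_thetaS (L : IsAlcoveLabelling cs crd) (m n : ℕ) {A B : ℤ}
    (hA : A = 2 * m + n + 2) (hB : B = m + 2 * n + 2) {w : W} (hw : crd w = (A, B - A, -B)) :
    crd '' {z | bruhatLE cs z w} = alcoveBox (-B, -B, -B) (A, A, A) := by
  have h := L.image_lower_thetaS_of_theta (A := A - 1) (B := B - 1) (by omega) (by omega)
    (by omega) (fun w hw => L.image_lower_theta m n (by omega) (by omega) hw) (w := w)
  rw [show -(B - 1) - 1 = -B by ring, show A - 1 + 1 = A by ring,
    show B - 1 - (A - 1) = B - A by ring] at h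
  exact h hw

theorem image_lower_simple_zero_mul_thetaS (L : IsAlcoveLabelling cs crd) (m n : ℕ) {A B : ℤ}
    (hA : A = 2 * m + n + 2) (hB : B = m + 2 * n + 2) {w : W} (hw : crd w = (A, B - A, -B)) :
    crd '' {z | bruhatLE cs z (cs.simple 0 * w)} =
      alcoveBox (-B - 3, -B, -B) (A, A, A + 3) := by
  refine L.image_lower_simple_mul 0 (L.image_lower_thetaS m n hA hB hw) ?_
    (alcoveBox_reflect (by omega) (by omega))
  rw [hw]
  simp only [reflectAlcove, mem_alcoveBox]
  omega

theorem crd_xelt_succ (L : IsAlcoveLabelling cs crd) (k : ℕ) :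
    crd (xelt cs (k + 1)) = adjacentAlcove (k + 2) (crd (xelt cs k)) := by
  rw [xelt, List.range_succ, List.map_append, List.prod_append]
  simp only [List.map_cons, List.map_nil, List.prod_singleton]
  rw [L.mul_simple]
  refine congrFun (adjacentAlcove_congr ?_) _
  push_cast
  omega

theorem crd_xelt_two_mul (L : IsAlcoveLabelling cs crd) (j : ℕ) :
    crd (xelt cs (2 * j)) = (2 * (j : ℤ) - 1, -(j : ℤ), 1 - (j : ℤ)) := by
  induction j with
  | zero => simpa [xelt] using L.one
  | succ j ih =>
    have h : crd (xelt cs (2 * j + 1)) = (2 * (j : ℤ), -(j : ℤ) - 1, 1 - (j : ℤ)) := by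
      rw [L.crd_xelt_succ, ih]
      exact adjacentAlcove_eq (by push_cast; omega) (by push_cast; omega) (by push_cast; omega)
    rw [show 2 * (j + 1) = 2 * j + 1 + 1 by ring, L.crd_xelt_succ, h]
    exact adjacentAlcove_eq (by push_cast; omega) (by push_cast; omega) (by push_cast; omega)

theorem crd_xelt_two_mul_add_one (L : IsAlcoveLabelling cs crd) (j : ℕ) :
    crd (xelt cs (2 * j + 1)) = (2 * (j : ℤ), -(j : ℤ) - 1, 1 - (j : ℤ)) := by
  rw [L.crd_xelt_succ, L.crd_xelt_two_mul]
  exact adjacentAlcove_eq (by push_cast; omega) (by push_cast; omega) (by push_cast; omega)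

theorem ncard_lower (L : IsAlcoveLabelling cs crd) {w : W} {T : Set (ℤ × ℤ × ℤ)}
    (h : crd '' {z | bruhatLE cs z w} = T) : {z | bruhatLE cs z w}.ncard = T.ncard := by
  rw [← h, Set.ncard_image_of_injective _ L.injective]

theorem crd_simple_one_mul_simple_two_mul_simple_one (L : IsAlcoveLabelling cs crd) :
    crd (cs.simple 1 * cs.simple 2 * cs.simple 1) = (1, 0, -1) := by
  rw [L.mul_simple, L.mul_simple, ← one_mul (cs.simple 1), L.mul_simple, L.one]
  decide

end IsAlcoveLabelling

end LowerSets

/-- cardinalities of the lower Bruhat intervals in type `Ã₂`. -/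
theorem statement4
    {W : Type*} [Group W] {M : CoxeterMatrix (Fin 3)} (cs : CoxeterSystem M W)
    (hM : ∀ i j : Fin 3, M i j = if i = j then 1 else 3)
    (act : W →* Equiv.Perm E2)
    (h0 : ∀ v, act (cs.simple 0) v = reflE rho2 (-1) v)
    (h1 : ∀ v, act (cs.simple 1) v = reflE a1 0 v)
    (h2 : ∀ v, act (cs.simple 2) v = reflE a2 0 v)
    (hcen : Function.Injective (cen act))
    (th ths : ℕ → ℕ → W)
    (hth : ∀ m n : ℕ, cen act (th m n) =
      cen act (cs.simple 1 * cs.simple 2 * cs.simple 1) + (m : ℝ) • fw1 + (n : ℝ) • fw2)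
    (hths : ∀ m n : ℕ, cen act (ths m n) =
      cen act 1 + ((m : ℝ) + 1) • fw1 + ((n : ℝ) + 1) • fw2) :
    (∀ m n : ℕ,
      {z : W | bruhatLE cs z (th m n)}.ncard =
        3*m^2 + 3*n^2 + 12*m*n + 9*m + 9*n + 6 ∧
      {z : W | bruhatLE cs z (ths m n)}.ncard =
        3*m^2 + 3*n^2 + 12*m*n + 15*m + 15*n + 12 ∧
      {z : W | bruhatLE cs z (cs.simple 0 * ths m n)}.ncard =
        3*m^2 + 3*n^2 + 12*m*n + 21*m + 21*n + 22) ∧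
    (∀ k : ℕ, 1 ≤ k →
      {z : W | bruhatLE cs z (xelt cs (2*k))}.ncard = 3*k^2 + k ∧
      {z : W | bruhatLE cs z (xelt cs (2*k+1))}.ncard = 3*k^2 + 5*k) := by
  obtain ⟨crd, L, hcrd⟩ := exists_isAlcoveLabelling cs act h0 h1 h2 hcen
  have crd_th (m n : ℕ) : crd (th m n) =
      ((2 * m + n + 1 : ℤ), (m + 2 * n + 1 : ℤ) - (2 * m + n + 1), -(m + 2 * n + 1 : ℤ)) := by
    refine alcoveCenter_injOn (L.isAlcove _).1 (by ring) ?_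
    rw [← hcrd, hth, hcrd, L.crd_simple_one_mul_simple_two_mul_simple_one]
    ext <;> simp [alcoveCenter, fw1, fw2] <;> ring
  have crd_ths (m n : ℕ) : crd (ths m n) =
      ((2 * m + n + 2 : ℤ), (m + 2 * n + 2 : ℤ) - (2 * m + n + 2), -(m + 2 * n + 2 : ℤ)) := by
    refine alcoveCenter_injOn (L.isAlcove _).1 (by ring) ?_
    rw [← hcrd, hths, hcrd, L.one]
    ext <;> simp [alcoveCenter, fw1, fw2] <;> ring
  refine ⟨fun m n => ?_, fun k hk => ⟨?_, ?_⟩⟩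
  · have card_ths : (alcoveBox (-(m + 2 * n + 2), -(m + 2 * n + 2), -(m + 2 * n + 2))
        (2 * m + n + 2, 2 * m + n + 2, 2 * m + n + 2)).ncard =
        3 * m ^ 2 + 3 * n ^ 2 + 12 * m * n + 15 * m + 15 * n + 12 := by
      have h := ncard_alcoveBox_thetaS m n rfl rfl
      rw [ncard_alcoveBox_theta m n rfl rfl] at h
      convert h using 1
      · ring_nf
      · ring
    refine ⟨?_, ?_, ?_⟩
    · rw [L.ncard_lower (L.image_lower_theta m n rfl rfl (crd_th m n)),
        ncard_alcoveBox_theta m n rfl rfl]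
    · rw [L.ncard_lower (L.image_lower_thetaS m n rfl rfl (crd_ths m n)), card_ths]
    · rw [L.ncard_lower (L.image_lower_simple_zero_mul_thetaS m n rfl rfl (crd_ths m n)),
        ncard_alcoveBox_reflect m n rfl rfl, card_ths]
      ring
  · rw [L.ncard_lower (L.image_lower_even hk (L.crd_xelt_two_mul k)), ncard_alcoveBox_two_mul hk]
  · rw [L.ncard_lower (L.image_lower_odd (by exact_mod_cast hk)
      (fun w hw => L.image_lower_even hk hw) (L.crd_xelt_two_mul_add_one k)),
      ncard_alcoveBox_two_mul_add_one]
end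
end
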